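/- The limit inferior of the sequence (S_n(12453))^{1/n} is at least 14.12 and its limit superior is at most 14.66; in particular, there is no integer m such that the sequence (S_n(12453))^{1/n} converges to m. -/

import Mathlib

/-- A permutation `p` of length `n` contains the pattern `q` of length `k`:
there are positions `f 0 < f 1 < … < f (k-1)` whose values are order-isomorphic to `q`. -/
def PermContains {n k : ℕ} (p : Equiv.Perm (Fin n)) (q : Equiv.Perm (Fin k)) : Prop :=
  ∃ f : Fin k → Fin n, StrictMono f ∧ ∀ a b : Fin k, p (f a) < p (f b) ↔ q a < q b

/-- `p` avoids the pattern `q`. -/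
def PermAvoids {n k : ℕ} (p : Equiv.Perm (Fin n)) (q : Equiv.Perm (Fin k)) : Prop :=
  ¬ PermContains p q

/-- `avoiders n q` is `S_n(q)`, the number of permutations of length `n` avoiding `q`. -/
noncomputable def avoiders (n : ℕ) {k : ℕ} (q : Equiv.Perm (Fin k)) : ℕ :=
  Nat.card {p : Equiv.Perm (Fin n) // PermAvoids p q}

/-- The pattern 12453 (0-indexed: 0,1,3,4,2). -/
def pat12453 : Equiv.Perm (Fin 5) :=
  ⟨![0, 1, 3, 4, 2], ![0, 1, 4, 2, 3], by decide, by decide⟩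

namespace StackMachine

variable {R : Type*} [CommRing R]

/-- The total length of the word encoded by a list of block lengths. -/
def weight (s : List ℕ) : ℕ := (s.map (· + 1)).sum

@[simp] lemma weight_nil : weight [] = 0 := rfl

@[simp] lemma weight_cons (c : ℕ) (s : List ℕ) : weight (c :: s) = c + 1 + weight s := by
  simp [weight]

/-- The sum of `φ` over all successors of a state of the stack machine (bottom of the stack first). -/
def succSum : List ℕ → (List ℕ → R) → R
  | [], φ => φ [0]
  | c :: s, φ => succSum s (fun s' => φ (c :: s')) + φ [weight s + c + 1] +
      ∑ e ∈ Finset.range c, φ [e, 0]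

/-- The sum of `φ` over the endpoints of all `n`-step runs from the empty stack. -/
def runSum : ℕ → (List ℕ → R) → R
  | 0, φ => φ []
  | n + 1, φ => runSum n (fun s => succSum s φ)

lemma succSum_add (s : List ℕ) (φ ψ : List ℕ → R) :
    succSum s (fun s => φ s + ψ s) = succSum s φ + succSum s ψ := by
  induction s generalizing φ ψ with
  | nil => simp [succSum]
  | cons c s ih => simp only [succSum, ih, Finset.sum_add_distrib]; ring

lemma succSum_mul (s : List ℕ) (r : R) (φ : List ℕ → R) :
    succSum s (fun s => r * φ s) = r * succSum s φ := by
  induction s generalizing φ with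
  | nil => simp [succSum]
  | cons c s ih => simp only [succSum, ih, Finset.mul_sum, mul_add]

lemma runSum_add (n : ℕ) (φ ψ : List ℕ → R) :
    runSum n (fun s => φ s + ψ s) = runSum n φ + runSum n ψ := by
  induction n generalizing φ ψ with
  | zero => simp [runSum]
  | succ n ih => simp only [runSum, succSum_add, ih]

lemma runSum_mul (n : ℕ) (r : R) (φ : List ℕ → R) :
    runSum n (fun s => r * φ s) = r * runSum n φ := by
  induction n generalizing φ with
  | zero => simp [runSum]
  | succ n ih => simp only [runSum, succSum_mul, ih]

lemma runSum_sub (n : ℕ) (φ ψ : List ℕ → R) :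
    runSum n (fun s => φ s - ψ s) = runSum n φ - runSum n ψ := by
  have h := runSum_add n φ (fun s => -1 * ψ s)
  rw [runSum_mul] at h
  simpa [sub_eq_add_neg] using h

lemma runSum_zero_fun (n : ℕ) : runSum n (fun _ => (0 : R)) = 0 := by
  simpa using runSum_mul n (0 : R) (fun _ => 0)

lemma succSum_eq_zero (s : List ℕ) (φ : List ℕ → R) (h : ∀ s, s ≠ [] → φ s = 0) :
    succSum s φ = 0 := by
  induction s generalizing φ with
  | nil => simp [succSum, h]
  | cons e s ih => simp [succSum, h, ih]

/-- Restriction of a test function to one-block stacks. -/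
def onSingle (ψ : ℕ → R) : List ℕ → R
  | [c] => ψ c
  | _ => 0

/-- Restriction of a test function to two-block stacks with trivial top block. -/
def onPair (ψ : ℕ → R) : List ℕ → R
  | [c, 0] => ψ c
  | _ => 0

/-- Runs ending in a one-block stack. -/
def singleSum (n : ℕ) (ψ : ℕ → R) : R := runSum n (onSingle ψ)

/-- Runs of length `n + 1` ending in a two-block stack with trivial top block. -/
def pairSum (n : ℕ) (ψ : ℕ → R) : R := runSum (n + 1) (onPair ψ)

lemma onPair_mul (r : R) (ψ : ℕ → R) (s : List ℕ) :
    onPair (fun c => ψ c * r) s = r * onPair ψ s := by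
  unfold onPair; split <;> simp [mul_comm]

lemma onSingle_sub (φ ψ : ℕ → R) (s : List ℕ) :
    onSingle (fun c => φ c - ψ c) s = onSingle φ s - onSingle ψ s := by
  unfold onSingle; split <;> simp

lemma onPair_sub (φ ψ : ℕ → R) (s : List ℕ) :
    onPair (fun c => φ c - ψ c) s = onPair φ s - onPair ψ s := by
  unfold onPair; split <;> simp

lemma pairSum_mul (n : ℕ) (r : R) (ψ : ℕ → R) :
    pairSum n (fun c => ψ c * r) = pairSum n ψ * r := by
  unfold pairSum
  rw [mul_comm, ← runSum_mul]
  congr 1; funext s; exact onPair_mul r ψ s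

lemma pairSum_sub (n : ℕ) (φ ψ : ℕ → R) :
    pairSum n (fun c => φ c - ψ c) = pairSum n φ - pairSum n ψ := by
  unfold pairSum
  rw [← runSum_sub]
  congr 1; funext s; exact onPair_sub φ ψ s

lemma pairSum_add (n : ℕ) (φ ψ : ℕ → R) :
    pairSum n (fun c => φ c + ψ c) = pairSum n φ + pairSum n ψ := by
  have h := pairSum_sub n (fun c => φ c + ψ c) ψ
  simp only [add_sub_cancel_right] at h
  rw [h]; ring

lemma singleSum_sub (n : ℕ) (φ ψ : ℕ → R) :
    singleSum n (fun c => φ c - ψ c) = singleSum n φ - singleSum n ψ := by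
  unfold singleSum
  rw [← runSum_sub]
  congr 1; funext s; exact onSingle_sub φ ψ s

lemma singleSum_add (n : ℕ) (φ ψ : ℕ → R) :
    singleSum n (fun c => φ c + ψ c) = singleSum n φ + singleSum n ψ := by
  have h := singleSum_sub n (fun c => φ c + ψ c) ψ
  simp only [add_sub_cancel_right] at h
  rw [h]; ring

lemma onPair_zero (s : List ℕ) : onPair (fun _ => (0 : R)) s = 0 := by
  unfold onPair; split <;> rfl

lemma pairSum_zero_fun (n : ℕ) : pairSum n (fun _ => (0 : R)) = 0 := by
  have h : (onPair (fun _ => (0 : R))) = fun _ => 0 := by funext s; exact onPair_zero s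
  rw [pairSum, h, runSum_zero_fun]

/-- Test functions supported on the one-block stack `[0]` and the empty stack only see
runs of length at most one. -/
lemma runSum_eq_zero_of_support (n : ℕ) (φ : List ℕ → R)
    (h : ∀ s, s ≠ [] → s ≠ [0] → φ s = 0) : runSum (n + 2) φ = 0 := by
  have h1 : ∀ s, s ≠ [] → succSum s φ = 0 := by
    intro s hs
    cases s with
    | nil => exact absurd rfl hs
    | cons c s =>
      have h2 : succSum s (fun s' => φ (c :: s')) = 0 := by
        cases s with
        | nil => simp [succSum, h]
        | cons d s =>
          exact succSum_eq_zero _ _ (fun s hs => h _ (by simp) (by simp [hs]))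
      simp [succSum, h2, h]
  have h3 : ∀ s, succSum s (fun s => succSum s φ) = 0 := by
    exact fun s => succSum_eq_zero _ _ h1
  simp only [runSum, h3, runSum_zero_fun]

/-- The contribution to `succSum` of the moves that touch the bottom block. -/
def bottomMoves (φ : List ℕ → R) (k c : ℕ) : R :=
  φ [k + c + 1] + ∑ e ∈ Finset.range c, φ [e, 0]

lemma succSum_cons (c : ℕ) (s : List ℕ) (φ : List ℕ → R) :
    succSum (c :: s) φ = succSum s (fun s' => φ (c :: s')) + bottomMoves φ (weight s) c := by
  simp [succSum, bottomMoves, add_assoc]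

/-- Decomposition of runs according to the last creation of the bottom block. -/
theorem runSum_decomp (n : ℕ) (φ : List ℕ → R) :
    runSum n φ = (if n = 0 then φ [] else 0) + singleSum n (fun c => φ [c]) +
      ∑ i ∈ Finset.range n, pairSum (n - 1 - i) (fun c => runSum (i + 1) (fun s => φ (c :: s))) := by
  induction n generalizing φ with
  | zero => simp [runSum, singleSum, onSingle]
  | succ n ih =>
    have key : ∀ χ : List ℕ → R, runSum (n + 1) χ =
        (if n = 0 then χ [0] else 0) + singleSum n (fun c => χ [c, 0]) +
        singleSum n (bottomMoves χ 0) +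
        ∑ i ∈ Finset.range n, pairSum (n - 1 - i)
          (fun c => runSum (i + 1) (fun s => bottomMoves χ (weight s) c)) +
        ∑ i ∈ Finset.range n, pairSum (n - 1 - i)
          (fun c => runSum (i + 2) (fun s => χ (c :: s))) := by
      intro χ
      have e1 : runSum (n + 1) χ = runSum n (fun s => succSum s χ) := rfl
      rw [e1, ih]
      simp only [succSum_cons, runSum_add, pairSum_add, singleSum_add, Finset.sum_add_distrib]
      simp only [succSum, weight_nil]
      have e2 : ∀ i c, runSum (i + 1) (fun s => succSum s (fun s' => χ (c :: s'))) =
          runSum (i + 2) (fun s => χ (c :: s)) := fun i c => rfl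
      simp only [e2]
      abel
    have hlast : ∑ i ∈ Finset.range (n + 1), pairSum (n + 1 - 1 - i)
          (fun c => runSum (i + 1) (fun s => φ (c :: s))) =
        pairSum n (fun c => φ [c, 0]) + ∑ i ∈ Finset.range n, pairSum (n - 1 - i)
          (fun c => runSum (i + 2) (fun s => φ (c :: s))) := by
      rw [Finset.sum_range_succ', add_comm]
      congr 1
      apply Finset.sum_congr rfl
      intro i _
      congr 1
      omega
    rw [hlast, key φ]
    let φ' : List ℕ → R := fun s => onSingle (fun c => φ [c]) s + onPair (fun c => φ [c, 0]) s
    have h' := key φ'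
    have e3 : runSum (n + 1) φ' = singleSum (n + 1) (fun c => φ [c]) +
        pairSum n (fun c => φ [c, 0]) := runSum_add _ _ _
    have e4 : bottomMoves φ' = bottomMoves φ := by
      funext k c; simp [bottomMoves, φ', onSingle, onPair]
    have e5 : ∀ i c, runSum (i + 2) (fun s => φ' (c :: s)) = 0 := by
      intro i c
      apply runSum_eq_zero_of_support
      intro s h1 h2
      match s, h1, h2 with
      | [d + 1], _, _ => simp [φ', onSingle, onPair]
      | d :: e :: s, _, _ => simp [φ', onSingle, onPair]
      | [0], _, h2 => exact absurd rfl h2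
      | [], h1, _ => exact absurd rfl h1
    have e6 : φ' [0] = φ [0] := by simp [φ', onSingle, onPair]
    have e7 : ∀ c, φ' [c, 0] = φ [c, 0] := by intro c; simp [φ', onSingle, onPair]
    simp only [e3, e4, e5, e6, e7, pairSum_zero_fun, Finset.sum_const_zero, add_zero] at h'
    rw [← h']
    simp
    ring

lemma succSum_onSingle (s : List ℕ) (ψ : ℕ → R) : succSum s (onSingle ψ) = ψ (weight s) := by
  cases s with
  | nil => simp [succSum, onSingle]
  | cons c s =>
    have h : succSum s (fun s' => onSingle ψ (c :: s')) = 0 := by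
      apply succSum_eq_zero
      intro s hs
      cases s with
      | nil => exact absurd rfl hs
      | cons d s => simp [onSingle]
    rw [succSum_cons, h]
    simp [bottomMoves, onSingle]
    congr 1; ring

/-- The sum of `ψ` over the proper predecessors of the bottom block. -/
def bottomBelow (ψ : ℕ → R) : List ℕ → R
  | [] => 0
  | c :: _ => ∑ e ∈ Finset.range c, ψ e

lemma succSum_onPair (s : List ℕ) (ψ : ℕ → R) :
    succSum s (onPair ψ) = onSingle ψ s + bottomBelow ψ s := by
  cases s with
  | nil => simp [succSum, onPair, onSingle, bottomBelow]
  | cons c s =>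
    rw [succSum_cons]
    simp only [bottomMoves, bottomBelow, onPair, zero_add]
    congr 1
    cases s with
    | nil => simp [succSum, onSingle]
    | cons d s =>
      rw [succSum_cons]
      rw [succSum_eq_zero]
      · simp [bottomMoves, onSingle]
      · intro s hs
        cases s with
        | nil => exact absurd rfl hs
        | cons e s => simp

open Polynomial in
/-- Generating polynomial of the endpoints of `n`-step runs, by weight. -/
noncomputable def weightPoly (n : ℕ) : ℚ[X] := runSum n (fun s => X ^ weight s)

lemma map_succSum {R S : Type*} [CommRing R] [CommRing S] (f : R →+* S) (s : List ℕ)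
    (φ : List ℕ → R) : f (succSum s φ) = succSum s (fun s => f (φ s)) := by
  induction s generalizing φ with
  | nil => simp [succSum]
  | cons c s ih => simp [succSum, ih]

lemma map_runSum {R S : Type*} [CommRing R] [CommRing S] (f : R →+* S) (n : ℕ)
    (φ : List ℕ → R) : f (runSum n φ) = runSum n (fun s => f (φ s)) := by
  induction n generalizing φ with
  | zero => simp [runSum]
  | succ n ih => simp [runSum, ih, map_succSum]

/-- The number of `n`-step runs. -/
def runCount (n : ℕ) : ℚ := runSum n (fun _ => 1)

lemma runCount_eq_eval (n : ℕ) : runCount n = (weightPoly n).eval 1 := by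
  have h := map_runSum (Polynomial.evalRingHom (1 : ℚ)) n
    (fun s => (Polynomial.X : Polynomial ℚ) ^ weight s)
  simp only [Polynomial.coe_evalRingHom, Polynomial.eval_pow, Polynomial.eval_X, one_pow] at h
  exact h.symm

lemma coeff_mul_of_shift {R : Type*} [CommRing R] (f : ℕ → R) (G : PowerSeries R) (n : ℕ) :
    PowerSeries.coeff n ((PowerSeries.mk f - PowerSeries.C (f 0)) * G) =
      ∑ i ∈ Finset.range n, f (i + 1) * PowerSeries.coeff (n - 1 - i) G := by
  have h : PowerSeries.mk f - PowerSeries.C (f 0) =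
      PowerSeries.X * PowerSeries.mk (fun n => f (n + 1)) := by
    ext m
    cases m with
    | zero => simp
    | succ m => simp [PowerSeries.coeff_succ_X_mul]
  rw [h, mul_assoc]
  cases n with
  | zero => simp
  | succ n =>
    rw [PowerSeries.coeff_succ_X_mul, PowerSeries.coeff_mul,
      Finset.Nat.sum_antidiagonal_eq_sum_range_succ
        (fun i j => PowerSeries.coeff i (PowerSeries.mk (fun n => f (n + 1))) *
          PowerSeries.coeff j G)]
    simp

/-- The functional equation with one catalytic variable satisfied by the generating function of
runs of the stack machine. -/
theorem functional_equation :
    (1 - PowerSeries.C Polynomial.X) * PowerSeries.mk (fun n => Polynomial.C (runCount n)) *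
        (PowerSeries.mk weightPoly - 1) =
      PowerSeries.C Polynomial.X * PowerSeries.X * PowerSeries.mk weightPoly *
        (PowerSeries.mk (fun n => Polynomial.C (runCount n)) -
          PowerSeries.C Polynomial.X * PowerSeries.mk weightPoly) := by
  let u : Polynomial ℚ := Polynomial.X
  let A : PowerSeries (Polynomial ℚ) := PowerSeries.mk fun n => singleSum n (fun c => u ^ c)
  let A1 : PowerSeries (Polynomial ℚ) := PowerSeries.mk fun n => singleSum n (fun _ => 1)
  let B : PowerSeries (Polynomial ℚ) := PowerSeries.mk fun n => pairSum n (fun c => u ^ c)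
  let B1 : PowerSeries (Polynomial ℚ) := PowerSeries.mk fun n => pairSum n (fun _ => 1)
  let Z : PowerSeries (Polynomial ℚ) := PowerSeries.mk weightPoly
  let z : PowerSeries (Polynomial ℚ) := PowerSeries.mk (fun n => Polynomial.C (runCount n))
  have hz : ∀ n, Polynomial.C (runCount n) = runSum n (fun _ => (1 : Polynomial ℚ)) := by
    intro n
    rw [runCount, map_runSum]; simp
  have hZ0 : weightPoly 0 = 1 := by simp [weightPoly, runSum]
  have hz0 : runCount 0 = 1 := by simp [runCount, runSum]
  have hcZ : ∀ (G : PowerSeries (Polynomial ℚ)) n, PowerSeries.coeff n ((Z - 1) * G) =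
      ∑ i ∈ Finset.range n, weightPoly (i + 1) * PowerSeries.coeff (n - 1 - i) G := by
    intro G n
    rw [← coeff_mul_of_shift, hZ0, map_one]
  have hcz : ∀ (G : PowerSeries (Polynomial ℚ)) n, PowerSeries.coeff n ((z - 1) * G) =
      ∑ i ∈ Finset.range n, Polynomial.C (runCount (i + 1)) * PowerSeries.coeff (n - 1 - i) G := by
    intro G n
    have := coeff_mul_of_shift (fun n => Polynomial.C (runCount n)) G n
    simpa [hz0] using this
  have e1 : Z = 1 + PowerSeries.C u * A + PowerSeries.C u * ((Z - 1) * B) := by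
    ext1 n
    rw [map_add, map_add, PowerSeries.coeff_C_mul, PowerSeries.coeff_C_mul, hcZ]
    simp only [Z, A, B, PowerSeries.coeff_mk, PowerSeries.coeff_one]
    have h := runSum_decomp n (fun s => u ^ weight s)
    have h1 : ∀ i c, runSum (i + 1) (fun s => u ^ weight (c :: s)) =
        u ^ c * (u * weightPoly (i + 1)) := by
      intro i c
      simp only [weight_cons, pow_add, pow_one, runSum_mul]
      rw [weightPoly]; ring
    have h2 : singleSum n (fun c => u ^ weight [c]) = u * singleSum n (fun c => u ^ c) := by
      unfold singleSum
      rw [← runSum_mul]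
      congr 1; funext s
      unfold onSingle; split <;> simp [pow_succ, mul_comm]
    simp only [h1, h2, pairSum_mul, weight_nil, pow_zero] at h
    rw [weightPoly, h, Finset.mul_sum]
    congr 1
    apply Finset.sum_congr rfl
    intros; ring
  have e2 : z = 1 + A1 + (z - 1) * B1 := by
    ext1 n
    rw [map_add, map_add, hcz]
    simp only [z, A1, B1, PowerSeries.coeff_mk, PowerSeries.coeff_one]
    have h := runSum_decomp n (fun _ => (1 : Polynomial ℚ))
    simp only [← hz] at h
    have h1 : ∀ j i, pairSum j (fun _ => Polynomial.C (runCount (i + 1))) =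
        pairSum j (fun _ => (1 : Polynomial ℚ)) * Polynomial.C (runCount (i + 1)) := by
      intro j i
      rw [← pairSum_mul]; simp
    simp only [h1] at h
    rw [h]
    congr 1
    apply Finset.sum_congr rfl
    intros; ring
  have e3 : A = PowerSeries.X * Z := by
    ext1 n
    cases n with
    | zero => simp [A, singleSum, runSum, onSingle]
    | succ n =>
      rw [PowerSeries.coeff_succ_X_mul]
      simp [A, Z, singleSum, runSum, succSum_onSingle, weightPoly, u]
  have e4 : (1 - PowerSeries.C u) * B = (1 - PowerSeries.C u) * A + (A1 - A) +
      (z - 1) * (B1 - B) := by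
    have hu : (1 - PowerSeries.C u) = PowerSeries.C (1 - u) := by simp
    rw [hu]
    ext1 n
    rw [map_add, map_add, PowerSeries.coeff_C_mul, PowerSeries.coeff_C_mul, hcz]
    simp only [A, A1, B, B1, PowerSeries.coeff_mk, map_sub]
    have h0 : pairSum n (fun c => u ^ c) = singleSum n (fun c => u ^ c) +
        runSum n (bottomBelow (fun c => u ^ c)) := by
      simp only [pairSum, runSum, succSum_onPair, runSum_add, singleSum]
    have h := runSum_decomp n (bottomBelow (fun c => u ^ c))
    simp only [bottomBelow, ite_self, zero_add] at h
    have hgeom : ∀ c, (1 - u) * ∑ e ∈ Finset.range c, u ^ e = 1 - u ^ c := fun c => mul_neg_geom_sum u c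
    have h1 : (1 - u) * singleSum n (fun c => ∑ e ∈ Finset.range c, u ^ e) =
        singleSum n (fun _ => 1) - singleSum n (fun c => u ^ c) := by
      rw [← singleSum_sub, singleSum, singleSum, ← runSum_mul]
      congr 1; funext s
      unfold onSingle; split <;> simp [hgeom]
    have h2 : ∀ j i, (1 - u) * pairSum j (fun c => runSum (i + 1)
          (fun _ => ∑ e ∈ Finset.range c, u ^ e)) =
        Polynomial.C (runCount (i + 1)) *
          (pairSum j (fun _ => 1) - pairSum j (fun c => u ^ c)) := by
      intro j i
      have h3 : ∀ c, runSum (i + 1) (fun _ => ∑ e ∈ Finset.range c, u ^ e) =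
          (∑ e ∈ Finset.range c, u ^ e) * Polynomial.C (runCount (i + 1)) := by
        intro c
        rw [hz, ← runSum_mul]; simp
      simp only [h3]
      rw [pairSum_mul, ← pairSum_sub, mul_comm _ (Polynomial.C _), mul_left_comm]
      congr 1
      simp only [← hgeom]
      rw [mul_comm, ← pairSum_mul]
      simp only [mul_comm]
    rw [h0, mul_add, h, mul_add, h1, Finset.mul_sum]
    simp only [h2]
    ring
  have e5 : (z - PowerSeries.C u) * B = z - 1 - PowerSeries.C u * A := by
    linear_combination e4 - e2
  change (1 - PowerSeries.C u) * z * (Z - 1) =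
    PowerSeries.C u * PowerSeries.X * Z * (z - PowerSeries.C u * Z)
  have e6 : PowerSeries.C u * ((Z - 1) * B) = Z - 1 - PowerSeries.C u * (PowerSeries.X * Z) := by
    rw [← e3]; linear_combination -e1
  rw [e3] at e5
  linear_combination PowerSeries.C u * (Z - 1) * e5 - (z - PowerSeries.C u) * e6

/-- The functional equation has at most one solution. -/
theorem functional_equation_unique (Z Z' : PowerSeries (Polynomial ℚ))
    (z z' : PowerSeries (Polynomial ℚ))
    (hz : z = PowerSeries.map (Polynomial.C.comp (Polynomial.evalRingHom 1)) Z)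
    (hz' : z' = PowerSeries.map (Polynomial.C.comp (Polynomial.evalRingHom 1)) Z')
    (h0 : PowerSeries.constantCoeff Z = 1) (h0' : PowerSeries.constantCoeff Z' = 1)
    (hE : (1 - PowerSeries.C Polynomial.X) * z * (Z - 1) =
      PowerSeries.C Polynomial.X * PowerSeries.X * Z * (z - PowerSeries.C Polynomial.X * Z))
    (hE' : (1 - PowerSeries.C Polynomial.X) * z' * (Z' - 1) =
      PowerSeries.C Polynomial.X * PowerSeries.X * Z' * (z' - PowerSeries.C Polynomial.X * Z')) :
    Z = Z' := by
  have hdvd : ∀ n : ℕ, (PowerSeries.X : PowerSeries (Polynomial ℚ)) ^ n ∣ Z - Z' := by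
    intro n
    induction n with
    | zero => simp
    | succ n ih =>
      have ihz : (PowerSeries.X : PowerSeries (Polynomial ℚ)) ^ n ∣ z - z' := by
        rw [hz, hz', ← map_sub]
        rw [PowerSeries.X_pow_dvd_iff] at ih ⊢
        intro m hm
        rw [PowerSeries.coeff_map, ih m hm, map_zero]
      have hZ1 : (PowerSeries.X : PowerSeries (Polynomial ℚ)) ∣ Z' - 1 := by
        rw [PowerSeries.X_dvd_iff]; simp [h0']
      obtain ⟨d, hd⟩ := ih
      obtain ⟨δ, hδ⟩ := ihz
      obtain ⟨w, hw⟩ := hZ1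
      have hkey : (1 - PowerSeries.C Polynomial.X) * z * (Z - Z') = PowerSeries.X ^ (n + 1) *
          (PowerSeries.C Polynomial.X * (d * (z - PowerSeries.C Polynomial.X * Z) +
            Z' * (δ - PowerSeries.C Polynomial.X * d)) -
            (1 - PowerSeries.C Polynomial.X) * δ * w) := by
        linear_combination hE - hE' + (PowerSeries.C Polynomial.X * PowerSeries.X *
            (z - PowerSeries.C Polynomial.X * Z) - PowerSeries.C Polynomial.X * PowerSeries.X *
            Z' * PowerSeries.C Polynomial.X) * hd +
          (PowerSeries.C Polynomial.X * PowerSeries.X * Z' -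
            (1 - PowerSeries.C Polynomial.X) * (Z' - 1)) * hδ -
          (1 - PowerSeries.C Polynomial.X) * PowerSeries.X ^ n * δ * hw
      have hz1 : PowerSeries.constantCoeff z = 1 := by
        rw [hz, ← PowerSeries.coeff_zero_eq_constantCoeff_apply, PowerSeries.coeff_map,
          PowerSeries.coeff_zero_eq_constantCoeff_apply, h0, map_one]
      have hunit : IsUnit z := by
        rw [PowerSeries.isUnit_iff_constantCoeff, hz1]; exact isUnit_one
      have h1 : (PowerSeries.X : PowerSeries (Polynomial ℚ)) ^ (n + 1) ∣
          z * ((1 - PowerSeries.C Polynomial.X) * (Z - Z')) := ⟨_, by rw [← hkey]; ring⟩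
      rw [hunit.dvd_mul_left] at h1
      have hu : (1 - PowerSeries.C (Polynomial.X : Polynomial ℚ)) =
        PowerSeries.C (1 - Polynomial.X) := by simp
      rw [hu, PowerSeries.X_pow_dvd_iff] at h1
      rw [PowerSeries.X_pow_dvd_iff]
      intro m hm
      have h2 := h1 m hm
      rw [PowerSeries.coeff_C_mul] at h2
      refine (mul_eq_zero.mp h2).resolve_left ?_
      intro h3
      have h4 := congrArg (Polynomial.eval 0) h3
      simp at h4
  have h : Z - Z' = 0 := by
    ext1 n
    simpa using (PowerSeries.X_pow_dvd_iff.mp (hdvd (n + 1))) n (Nat.lt_succ_self n)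
  exact sub_eq_zero.mp h

/-- The generating function of `2 ^ n * catalan n`. -/
noncomputable def catalanTwo : PowerSeries ℚ :=
  PowerSeries.rescale 2 (PowerSeries.map (Nat.castRingHom ℚ) PowerSeries.catalanSeries)

lemma coeff_catalanTwo (n : ℕ) :
    PowerSeries.coeff n catalanTwo = 2 ^ n * (catalan n : ℚ) := by
  simp [catalanTwo, PowerSeries.coeff_rescale]

lemma catalan_map_eq (R : Type*) [CommRing R] :
    (PowerSeries.map (Nat.castRingHom R) PowerSeries.catalanSeries) ^ 2 * PowerSeries.X + 1 =
      PowerSeries.map (Nat.castRingHom R) PowerSeries.catalanSeries := by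
  have h := congrArg (PowerSeries.map (Nat.castRingHom R))
    PowerSeries.catalanSeries_sq_mul_X_add_one
  simpa using h

lemma catalanTwo_eq : catalanTwo = 1 + 2 * PowerSeries.X * catalanTwo ^ 2 := by
  have h := congrArg (PowerSeries.rescale (2 : ℚ)) (catalan_map_eq ℚ)
  simp only [map_add, map_mul, map_pow, map_one, PowerSeries.rescale_X] at h
  rw [show (PowerSeries.C (2 : ℚ)) = 2 from map_ofNat _ 2] at h
  change catalanTwo ^ 2 * (2 * PowerSeries.X) + 1 = catalanTwo at h
  linear_combination -h

/-- Every power series `a` without constant term has a solution of `y = 1 + a * y ^ 2`. -/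
lemma exists_catalan_solution {R : Type*} [CommRing R] (a : PowerSeries R)
    (ha : PowerSeries.constantCoeff a = 0) : ∃ y : PowerSeries R, y = 1 + a * y ^ 2 := by
  have hs := PowerSeries.HasSubst.of_constantCoeff_zero' ha
  have h := congrArg (PowerSeries.substAlgHom (R := R) hs) (catalan_map_eq R)
  simp only [map_add, map_mul, map_pow, map_one, PowerSeries.substAlgHom_X] at h
  refine ⟨PowerSeries.substAlgHom hs (PowerSeries.map (Nat.castRingHom R)
    PowerSeries.catalanSeries), ?_⟩
  linear_combination -h

lemma functional_equation_solution {A : Type*} [CommRing A] {x t u y w z Z : A}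
    (hx : x = t - 2 * t ^ 2) (hy : y = 1 + t * (1 - t) * u * y ^ 2) (hw : (1 - t) * w = 1)
    (hz : z = w * (1 - t * w) * w) (hZ : Z = y * (1 - t * y) * w) :
    (1 - u) * z * (Z - 1) = u * x * Z * (z - u * Z) := by
  have h1 : z = (1 - 2 * t) * w ^ 3 := by
    rw [hz]; linear_combination -w ^ 2 * hw
  have h2 : Z - 1 = w * (y - t * y ^ 2 - (1 - t)) := by
    rw [hZ]; linear_combination hw
  have h3 : z - u * Z = w ^ 3 * (1 - 2 * t - u * y * (1 - t * y) * (1 - t) ^ 2) := by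
    rw [h1, hZ]
    linear_combination u * y * (1 - t * y) * w * ((1 - t) * w + 1) * hw
  have key : (1 - u) * (y - t * y ^ 2 - (1 - t)) =
      u * t * y * (1 - t * y) * (1 - 2 * t - u * y * (1 - t * y) * (1 - t) ^ 2) := by
    linear_combination ((1 - t - t * y) - u * (1 - t * y) ^ 2 * (1 - t)) * hy
  rw [h3, h2, h1, hZ, hx]
  linear_combination (1 - 2 * t) * w ^ 4 * key

/-- The generating function of `runCount`, in terms of `catalanTwo`. -/
theorem mk_runCount_mul_cube :
    PowerSeries.mk runCount * (1 - PowerSeries.X * catalanTwo) ^ 3 =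
      1 - 2 * (PowerSeries.X * catalanTwo) := by
  let t0 : PowerSeries ℚ := PowerSeries.X * catalanTwo
  have ht0 : (PowerSeries.X : PowerSeries ℚ) = t0 - 2 * t0 ^ 2 := by
    simp only [t0]; linear_combination -PowerSeries.X * catalanTwo_eq
  let e : Polynomial ℚ →+* Polynomial ℚ := Polynomial.C.comp (Polynomial.evalRingHom 1)
  let t : PowerSeries (Polynomial ℚ) := PowerSeries.map Polynomial.C t0
  have ht : (PowerSeries.X : PowerSeries (Polynomial ℚ)) = t - 2 * t ^ 2 := by
    have := congrArg (PowerSeries.map (Polynomial.C : ℚ →+* Polynomial ℚ)) ht0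
    simpa only [map_sub, map_mul, map_pow, map_ofNat, PowerSeries.map_X] using this
  have het : PowerSeries.map e t = t := by
    ext1 n; simp [t, e]
  have hct : PowerSeries.constantCoeff t = 0 := by
    rw [← PowerSeries.coeff_zero_eq_constantCoeff_apply]
    simp [t, t0]
  obtain ⟨y, hy⟩ := exists_catalan_solution
    (t * (1 - t) * PowerSeries.C (Polynomial.X : Polynomial ℚ)) (by simp [hct])
  have hcy : PowerSeries.constantCoeff y = 1 := by
    have h := congrArg PowerSeries.constantCoeff hy
    simpa [hct] using h
  let w := PowerSeries.map e y
  have hcw : PowerSeries.constantCoeff w = 1 := by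
    rw [← PowerSeries.coeff_zero_eq_constantCoeff_apply]
    simp [w, hcy]
  have heu : PowerSeries.map e (PowerSeries.C (Polynomial.X : Polynomial ℚ)) = 1 := by
    rw [PowerSeries.map_C]; simp [e]
  have hw' : w = 1 + t * (1 - t) * w ^ 2 := by
    have h := congrArg (PowerSeries.map e) hy
    simpa only [map_add, map_mul, map_sub, map_one, map_pow, het, heu, mul_one] using h
  have hew : PowerSeries.map e w = w := by
    ext1 n; simp [w, e]
  have hw : (1 - t) * w = 1 := by
    have h : ((1 - t) * w - 1) * (t * w - 1) = 0 := by linear_combination -hw'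
    rcases mul_eq_zero.mp h with h | h
    · linear_combination h
    · have := congrArg PowerSeries.constantCoeff h
      simp [hct] at this
  have hmain : PowerSeries.mk weightPoly = y * (1 - t * y) * w := by
    refine functional_equation_unique _ _ (PowerSeries.mk (fun n => Polynomial.C (runCount n)))
      (w * (1 - t * w) * w) ?_ ?_ ?_ ?_ functional_equation ?_
    · ext1 n; simp [runCount_eq_eval]
    · change _ = PowerSeries.map e _
      simp only [map_mul, map_sub, map_one, hew, het]; rfl
    · simp [weightPoly, runSum]
    · simp [hcy, hct, hcw]
    · exact functional_equation_solution ht hy hw rfl rfl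
  have h1 : PowerSeries.mk (fun n => Polynomial.C (runCount n)) * (1 - t) ^ 3 = 1 - 2 * t := by
    have h := congrArg (PowerSeries.map e) hmain
    simp only [map_mul, map_sub, map_one, hew, het] at h
    have h' : PowerSeries.map e (PowerSeries.mk weightPoly) =
        PowerSeries.mk (fun n => Polynomial.C (runCount n)) := by
      ext1 n; simp [runCount_eq_eval, e]
    rw [h'] at h
    change _ = w * (1 - t * w) * w at h
    rw [h]
    linear_combination ((1 - t) * ((1 - t) * w + 1) -
      t * (((1 - t) * w) ^ 2 + (1 - t) * w + 1)) * hw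
  have h2 := congrArg (PowerSeries.map (Polynomial.evalRingHom (1 : ℚ))) h1
  have h3 : PowerSeries.map (Polynomial.evalRingHom (1 : ℚ)) t = t0 := by
    ext1 n; simp [t]
  have h4 : PowerSeries.map (Polynomial.evalRingHom (1 : ℚ))
      (PowerSeries.mk (fun n => Polynomial.C (runCount n))) = PowerSeries.mk runCount := by
    ext1 n; simp
  simpa only [map_mul, map_sub, map_one, map_pow, map_ofNat, h3, h4] using h2

/-- Increments in the renewal equation for `runCount`. -/
noncomputable def renewal : PowerSeries ℚ :=
  1 + 2 * PowerSeries.X - catalanTwo + 8 * (PowerSeries.X * catalanTwo)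

theorem renewal_equation :
    8 * PowerSeries.mk runCount = 8 + PowerSeries.mk runCount * renewal := by
  have h := mk_runCount_mul_cube
  have hc := catalanTwo_eq
  set T := catalanTwo
  set x : PowerSeries ℚ := PowerSeries.X
  set z := PowerSeries.mk runCount
  have h1 : T * (1 - 2 * (x * T)) = 1 := by linear_combination hc
  have h2 : z * T * (1 - x * T) ^ 3 = 1 := by linear_combination T * h + h1
  have h3 : 8 * T * (1 - x * T) ^ 3 = T * (1 - 8 * x) + 7 - 2 * x := by
    linear_combination (7 - 10 * x * T + 4 * x ^ 2 * T ^ 2 - 2 * x) * h1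
  simp only [renewal]
  linear_combination 8 * h2 - z * h3

lemma succ_mul_catalan_succ (n : ℕ) :
    ((n : ℚ) + 2) * catalan (n + 1) = 2 * (2 * n + 1) * catalan n := by
  have h1 := succ_mul_catalan_eq_centralBinom (n + 1)
  have h2 := succ_mul_catalan_eq_centralBinom n
  have h3 := Nat.succ_mul_centralBinom_succ n
  have h4 : ((n : ℚ) + 1) ≠ 0 := by positivity
  have e1 : ((n : ℚ) + 1 + 1) * catalan (n + 1) = Nat.centralBinom (n + 1) := by exact_mod_cast h1
  have e2 : ((n : ℚ) + 1) * catalan n = Nat.centralBinom n := by exact_mod_cast h2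
  have e3 : ((n : ℚ) + 1) * Nat.centralBinom (n + 1) = 2 * (2 * n + 1) * Nat.centralBinom n := by
    exact_mod_cast h3
  apply mul_left_cancel₀ h4
  linear_combination ((n : ℚ) + 1) * e1 + e3 - 2 * (2 * n + 1) * e2

lemma coeff_renewal_zero : PowerSeries.coeff 0 renewal = 0 := by
  simp only [renewal, map_add, map_sub, coeff_catalanTwo, PowerSeries.coeff_zero_eq_constantCoeff]
  simp

lemma coeff_renewal_succ (n : ℕ) : PowerSeries.coeff (n + 1) renewal =
    (if n = 0 then 2 else 0) + 8 * (2 ^ n * catalan n) - 2 ^ (n + 1) * catalan (n + 1) := by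
  have e2 : (2 : PowerSeries ℚ) = PowerSeries.C 2 := (map_ofNat _ 2).symm
  have e8 : (8 : PowerSeries ℚ) = PowerSeries.C 8 := (map_ofNat _ 8).symm
  rw [renewal, e2, e8]
  simp only [map_add, map_sub, PowerSeries.coeff_C_mul, PowerSeries.coeff_succ_X_mul,
    coeff_catalanTwo, PowerSeries.coeff_one, PowerSeries.coeff_X]
  simp
  ring

lemma coeff_renewal_succ' (n : ℕ) : PowerSeries.coeff (n + 1) renewal =
    (if n = 0 then 2 else 0) + 2 ^ n * (12 * catalan n / (n + 2)) := by
  have h := succ_mul_catalan_succ n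
  have h2 : ((n : ℚ) + 2) ≠ 0 := by positivity
  have h3 : (catalan (n + 1) : ℚ) = 2 * (2 * n + 1) * catalan n / (n + 2) := by
    field_simp; linear_combination h
  rw [coeff_renewal_succ, h3, pow_succ]
  field_simp
  ring

lemma coeff_renewal_nonneg (n : ℕ) : 0 ≤ PowerSeries.coeff n renewal := by
  cases n with
  | zero => rw [coeff_renewal_zero]
  | succ n =>
    rw [coeff_renewal_succ']
    split_ifs <;> positivity

lemma sum_renewal (n : ℕ) :
    ∑ i ∈ Finset.range (n + 1), PowerSeries.coeff (i + 1) renewal / 8 ^ (i + 1) =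
      5 / 4 - 2 ^ (n + 1) * catalan (n + 1) / 8 ^ (n + 1) := by
  induction n with
  | zero => rw [Finset.sum_range_one, coeff_renewal_succ]; norm_num
  | succ n ih =>
    rw [Finset.sum_range_succ, ih, coeff_renewal_succ]
    simp only [Nat.add_eq_zero_iff, one_ne_zero, and_false, if_false]
    field_simp
    ring

lemma runCount_renewal (n : ℕ) : 8 * runCount (n + 1) =
    ∑ i ∈ Finset.range (n + 1), PowerSeries.coeff (i + 1) renewal * runCount (n - i) := by
  have e8 : (8 : PowerSeries ℚ) = PowerSeries.C 8 := (map_ofNat _ 8).symm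
  have h := congrArg (PowerSeries.coeff (n + 1)) renewal_equation
  rw [e8, PowerSeries.coeff_C_mul, map_add, mul_comm (PowerSeries.mk runCount),
    PowerSeries.coeff_mul, Finset.Nat.sum_antidiagonal_eq_sum_range_succ
        (fun i j => PowerSeries.coeff i renewal *
          PowerSeries.coeff j (PowerSeries.mk runCount)), Finset.sum_range_succ',
    coeff_renewal_zero, PowerSeries.coeff_C] at h
  simpa using h

lemma runCount_zero : runCount 0 = 1 := by simp [runCount, runSum]

lemma runCount_nonneg (n : ℕ) : 0 ≤ runCount n := by
  induction n using Nat.strong_induction_on with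
  | _ n ih =>
    cases n with
    | zero => simp [runCount_zero]
    | succ n =>
      have h := runCount_renewal n
      have : 0 ≤ 8 * runCount (n + 1) := by
        rw [h]
        exact Finset.sum_nonneg fun i _ => mul_nonneg (coeff_renewal_nonneg _) (ih _ (by omega))
      linarith

theorem runCount_le (n : ℕ) : runCount n ≤ 8 ^ n := by
  induction n using Nat.strong_induction_on with
  | _ n ih =>
    cases n with
    | zero => simp [runCount_zero]
    | succ n =>
      have h1 : 8 * runCount (n + 1) ≤ 8 ^ (n + 1) *
          ∑ i ∈ Finset.range (n + 1), PowerSeries.coeff (i + 1) renewal / 8 ^ (i + 1) := by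
        rw [runCount_renewal, Finset.mul_sum]
        apply Finset.sum_le_sum
        intro i hi
        have hi' : i ≤ n := Nat.lt_succ_iff.mp (Finset.mem_range.mp hi)
        have h2 : (8 : ℚ) ^ (n + 1) = 8 ^ (n - i) * 8 ^ (i + 1) := by
          rw [← pow_add]; congr 1; omega
        calc _ ≤ PowerSeries.coeff (i + 1) renewal * 8 ^ (n - i) :=
              mul_le_mul_of_nonneg_left (ih _ (by omega)) (coeff_renewal_nonneg _)
          _ = _ := by rw [h2]; field_simp
      rw [sum_renewal] at h1
      have h3 : (0 : ℚ) ≤ 2 ^ (n + 1) * catalan (n + 1) / 8 ^ (n + 1) := by positivity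
      have h4 : (0 : ℚ) < 8 ^ (n + 1) := by positivity
      nlinarith [mul_nonneg h4.le h3]

theorem le_runCount (n : ℕ) : (8 : ℚ) ^ n / (16 * (n + 1) ^ 3) ≤ runCount n := by
  rcases n with _ | n
  · norm_num [runCount_zero]
  have h1 : PowerSeries.coeff (n + 1) renewal ≤ 8 * runCount (n + 1) := by
    rw [runCount_renewal, Finset.sum_range_succ]
    simp only [Nat.sub_self, runCount_zero, mul_one]
    exact le_add_of_nonneg_left (Finset.sum_nonneg fun i _ =>
      mul_nonneg (coeff_renewal_nonneg _) (runCount_nonneg _))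
  have h2 : 2 ^ n * (12 * catalan n / ((n : ℚ) + 2)) ≤ PowerSeries.coeff (n + 1) renewal := by
    rw [coeff_renewal_succ']; split_ifs <;> simp
  have h3 : (4 : ℚ) ^ n ≤ 2 * (n + 1) * ((n + 1) * catalan n) := by
    have e : ((n : ℚ) + 1) * catalan n = Nat.centralBinom n := by
      exact_mod_cast succ_mul_catalan_eq_centralBinom n
    rw [e]
    rcases Nat.eq_zero_or_pos n with rfl | hn
    · norm_num
    · have h : (4 : ℚ) ^ n ≤ 2 * n * Nat.centralBinom n := by
        exact_mod_cast Nat.four_pow_le_two_mul_self_mul_centralBinom n hn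
      have : (0 : ℚ) ≤ Nat.centralBinom n := by positivity
      nlinarith
  have h4 : (8 : ℚ) ^ n = 2 ^ n * 4 ^ n := by rw [← mul_pow]; norm_num
  push_cast
  have h5 : (8 : ℚ) ^ (n + 1) / (16 * (n + 1 + 1) ^ 3) ≤
      2 ^ n * (12 * catalan n / ((n : ℚ) + 2)) / 8 := by
    rw [pow_succ, h4, div_le_div_iff₀ (by positivity) (by positivity)]
    rw [mul_div_assoc', div_mul_eq_mul_div, le_div_iff₀ (by positivity)]
    have h6 : (0 : ℚ) ≤ catalan n := by positivity
    have h7 : (0 : ℚ) ≤ n := by positivity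
    have h8 : (4 : ℚ) ^ n * (n + 2) * 4 ≤ 12 * catalan n * (n + 2) ^ 3 := by
      have : (4 : ℚ) ^ n * 4 ≤ 12 * catalan n * (n + 2) ^ 2 := by
        nlinarith [mul_nonneg h6 h7, mul_nonneg h6 (mul_nonneg h7 h7)]
      nlinarith
    have h9 : (0 : ℚ) < 2 ^ n := by positivity
    have h10 := mul_le_mul_of_nonneg_left h8 h9.le
    ring_nf at h10 ⊢
    linarith
  linarith

/-- Sum over the successors of a word: the new maximum is inserted at every admissible place. -/
def wordSuccSum {R : Type*} [CommRing R] : List Bool → (List Bool → R) → R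
  | [], φ => φ [true]
  | b :: w, φ => φ (true :: if b then List.replicate (w.length + 1) false else []) +
      wordSuccSum w (fun w' => φ (b :: w'))

/-- The word encoded by a stack. -/
def toWord (s : List ℕ) : List Bool := s.flatMap fun c => true :: List.replicate c false

lemma toWord_cons (c : ℕ) (s : List ℕ) :
    toWord (c :: s) = true :: (List.replicate c false ++ toWord s) := by
  simp [toWord]

lemma length_toWord (s : List ℕ) : (toWord s).length = weight s := by
  induction s with
  | nil => simp [toWord]
  | cons c s ih => rw [toWord_cons]; simp [ih]; ring

lemma wordSuccSum_replicate {R : Type*} [CommRing R] (c : ℕ) (w : List Bool)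
    (φ : List Bool → R) : wordSuccSum (List.replicate c false ++ w) φ =
      wordSuccSum w (fun w' => φ (List.replicate c false ++ w')) +
        ∑ e ∈ Finset.range c, φ (List.replicate e false ++ [true]) := by
  induction c generalizing φ with
  | zero => simp
  | succ c ih =>
    rw [List.replicate_succ, List.cons_append, wordSuccSum, ih, Finset.sum_range_succ']
    simp only [Bool.false_eq_true, if_false, List.replicate_succ, List.cons_append,
      List.replicate_zero, List.nil_append]
    ring

lemma wordSuccSum_toWord {R : Type*} [CommRing R] (s : List ℕ) (φ : List Bool → R) :
    wordSuccSum (toWord s) φ = succSum s (fun s' => φ (toWord s')) := by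
  induction s generalizing φ with
  | nil => simp [toWord, wordSuccSum, succSum]
  | cons c s ih =>
    rw [toWord_cons, wordSuccSum, wordSuccSum_replicate, ih, succSum]
    simp only [toWord_cons, List.length_append, List.length_replicate, length_toWord, if_true]
    rw [show c + weight s + 1 = weight s + c + 1 by ring]
    simp [toWord]
    ring

/-- The effect on words of inserting a new maximum. -/
def wordStep : List Bool → ℕ → List Bool
  | [], _ => [true]
  | b :: w, 0 => true :: if b then List.replicate (w.length + 1) false else []
  | b :: w, j + 1 => b :: wordStep w j

lemma sum_wordStep {R : Type*} [CommRing R] (w : List Bool) (φ : List Bool → R) :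
    ((List.range (w.length + 1)).map fun j => φ (wordStep w j)).sum = wordSuccSum w φ := by
  induction w generalizing φ with
  | nil => simp [wordStep, wordSuccSum]
  | cons b w ih =>
    rw [List.length_cons, List.range_succ_eq_map, List.map_cons, List.sum_cons, List.map_map,
      wordSuccSum, ← ih]
    rfl

/-- `l` contains the pattern `231`. -/
def Has231 (l : List ℕ) : Prop := ∃ a b c, [b, c, a].Sublist l ∧ a < b ∧ b < c

/-- `l` contains the pattern `2314`. -/
def Has2314 (l : List ℕ) : Prop := ∃ a b c d, [b, c, a, d].Sublist l ∧ a < b ∧ b < c ∧ c < d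

/-- Appending `x` to `pre` creates a pattern `231`. -/
def Completes (pre : List ℕ) (x : ℕ) : Prop := ∃ b c, [b, c].Sublist pre ∧ x < b ∧ b < c

open Classical in
/-- The left-to-right maximum indicator of the longest `231`-avoiding initial segment. -/
noncomputable def word : List ℕ → List ℕ → List Bool
  | _, [] => []
  | pre, x :: xs => if Completes pre x then [] else
      decide (∀ a ∈ pre, a < x) :: word (pre ++ [x]) xs

lemma has231_append_singleton (pre : List ℕ) (x : ℕ) :
    Has231 (pre ++ [x]) ↔ Has231 pre ∨ Completes pre x := by
  constructor
  · rintro ⟨a, b, c, h, h1, h2⟩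
    rw [List.sublist_append_iff] at h
    obtain ⟨l1, l2, e, s1, s2⟩ := h
    rcases List.sublist_cons_iff.mp s2 with h | ⟨r, rfl, h⟩
    · rw [List.sublist_nil.mp h, List.append_nil] at e
      exact Or.inl ⟨a, b, c, e ▸ s1, h1, h2⟩
    · rw [List.sublist_nil.mp h] at e
      have e' : [b, c] ++ [a] = l1 ++ [x] := e
      obtain ⟨rfl, e3⟩ := List.append_inj' e' rfl
      obtain rfl : a = x := by simpa using e3
      exact Or.inr ⟨b, c, s1, h1, h2⟩
  · rintro (⟨a, b, c, h, h1, h2⟩ | ⟨b, c, h, h1, h2⟩)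
    · exact ⟨a, b, c, h.trans (List.sublist_append_left _ _), h1, h2⟩
    · exact ⟨x, b, c, h.append (List.Sublist.refl [x]), h1, h2⟩

lemma Has231.mono {l l' : List ℕ} (h : l.Sublist l') : Has231 l → Has231 l' :=
  fun ⟨a, b, c, hs, h1, h2⟩ => ⟨a, b, c, hs.trans h, h1, h2⟩

lemma Completes.mono {l l' : List ℕ} {x : ℕ} (h : l.Sublist l') :
    Completes l x → Completes l' x :=
  fun ⟨b, c, hs, h1, h2⟩ => ⟨b, c, hs.trans h, h1, h2⟩

lemma length_word_le (pre l : List ℕ) : (word pre l).length ≤ l.length := by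
  induction l generalizing pre with
  | nil => simp [word]
  | cons x xs ih =>
    rw [word]; split_ifs
    · simp
    · simpa using ih _

lemma le_length_word_iff (pre l : List ℕ) (hpre : ¬ Has231 pre) (j : ℕ) (hj : j ≤ l.length) :
    j ≤ (word pre l).length ↔ ¬ Has231 (pre ++ l.take j) := by
  induction l generalizing pre j with
  | nil =>
    obtain rfl : j = 0 := by simpa using hj
    simpa using hpre
  | cons x xs ih =>
    cases j with
    | zero => simpa using hpre
    | succ j =>
      rw [word, List.take_succ_cons]
      have e : pre ++ x :: xs.take j = pre ++ [x] ++ xs.take j := by simp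
      split_ifs with h
      · simp only [List.length_nil, nonpos_iff_eq_zero, Nat.add_eq_zero_iff, one_ne_zero, and_false,
          false_iff, not_not]
        rw [e]
        exact Has231.mono (List.sublist_append_left _ _)
          ((has231_append_singleton _ _).mpr (Or.inr h))
      · rw [List.length_cons, Nat.succ_le_succ_iff, e]
        apply ih
        · rw [has231_append_singleton]; tauto
        · simpa using hj

lemma pair_sublist_insert {xs ys : List ℕ} {N b c : ℕ} (h : [b, c].Sublist (xs ++ N :: ys)) :
    [b, c].Sublist (xs ++ ys) ∨ (b ∈ xs ∧ c = N) ∨ (b = N ∧ c ∈ ys) := by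
  rw [List.sublist_append_iff] at h
  obtain ⟨l1, l2, e, s1, s2⟩ := h
  rcases List.sublist_cons_iff.mp s2 with h | ⟨r, rfl, h⟩
  · left; rw [e]; exact s1.append h
  · rcases l1 with _ | ⟨p, _ | ⟨q, l1⟩⟩
    · simp only [List.nil_append, List.cons.injEq] at e
      obtain ⟨rfl, rfl⟩ := e
      exact Or.inr (Or.inr ⟨rfl, by simpa using h⟩)
    · simp only [List.cons_append, List.nil_append, List.cons.injEq] at e
      obtain ⟨rfl, rfl, rfl⟩ := e
      exact Or.inr (Or.inl ⟨by simpa using s1, rfl⟩)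
    · simp at e

lemma completes_insert_of_big {pre mid : List ℕ} {N x y : ℕ} (hx : ∀ a ∈ pre, a < x)
    (hmid : ∀ a ∈ mid, a < N) (hxN : x < N) :
    Completes (pre ++ N :: x :: mid) y ↔ Completes (pre ++ x :: mid) y := by
  constructor
  · rintro ⟨b, c, h, h1, h2⟩
    rcases pair_sublist_insert h with h' | ⟨h', rfl⟩ | ⟨rfl, h'⟩
    · exact ⟨b, c, h', h1, h2⟩
    · refine ⟨b, x, ?_, h1, hx b h'⟩
      exact (List.singleton_sublist.mpr h').append
        (List.singleton_sublist.mpr (List.mem_cons_self))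
    · rcases List.mem_cons.mp h' with rfl | h'
      · omega
      · have := hmid c h'; omega
  · exact Completes.mono ((List.Sublist.refl pre).append (List.sublist_cons_self _ _))

lemma word_insert_tail {pre mid ys : List ℕ} {N x : ℕ} (hx : ∀ a ∈ pre, a < x)
    (hmid : ∀ a ∈ mid, a < N) (hxN : x < N) (hys : ∀ a ∈ ys, a < N) :
    word (pre ++ N :: x :: mid) ys =
      List.replicate (word (pre ++ x :: mid) ys).length false := by
  induction ys generalizing mid with
  | nil => simp [word]
  | cons y ys ih =>
    have hy : y < N := hys y List.mem_cons_self
    have h := ih (mid := mid ++ [y]) (by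
      intro a ha
      rcases List.mem_append.mp ha with ha | ha
      · exact hmid a ha
      · rw [List.mem_singleton.mp ha]; exact hy) (fun a ha => hys a (List.mem_cons_of_mem _ ha))
    rw [word, word]
    by_cases hc : Completes (pre ++ x :: mid) y
    · rw [if_pos hc, if_pos ((completes_insert_of_big hx hmid hxN).mpr hc)]
      simp
    · rw [if_neg hc, if_neg (mt (completes_insert_of_big hx hmid hxN).mp hc)]
      have hd : ¬ ∀ a ∈ pre ++ N :: x :: mid, a < y := by
        intro h
        have := h N (by simp)
        omega
      rw [List.length_cons, List.replicate_succ, decide_eq_false hd]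
      simpa using h

lemma word_insert_head {pre ys : List ℕ} {N : ℕ} (hpre : ∀ a ∈ pre, a < N)
    (hys : ∀ a ∈ ys, a < N) (hnd : (pre ++ ys).Nodup) :
    word pre (N :: ys) = wordStep (word pre ys) 0 := by
  have hN : ¬ Completes pre N := by
    rintro ⟨b, c, h, h1, h2⟩
    have := hpre b (h.subset (by simp))
    omega
  rw [word, if_neg hN, decide_eq_true hpre]
  cases ys with
  | nil => simp [word, wordStep]
  | cons x ys =>
    have hxN := hys x List.mem_cons_self
    by_cases h : Completes pre x
    · rw [word, word, if_pos (h.mono (List.sublist_append_left _ _)), if_pos h, wordStep]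
    · rw [word.eq_2 pre, if_neg h, wordStep]
      by_cases hm : ∀ a ∈ pre, a < x
      · rw [decide_eq_true hm, if_pos rfl, word, if_neg, decide_eq_false]
        · have := word_insert_tail (mid := []) (ys := ys) hm (by simp) hxN
            (fun a ha => hys a (List.mem_cons_of_mem _ ha))
          simp only [List.append_assoc, List.cons_append, List.nil_append, this,
            List.replicate_succ]
        · intro h
          have := h N (by simp)
          omega
        · rintro ⟨b, c, h, h1, h2⟩
          rcases pair_sublist_insert h with h' | ⟨h', rfl⟩ | ⟨rfl, h'⟩
          · rw [List.append_nil] at h'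
            have := hm b (h'.subset (by simp))
            omega
          · have := hm b h'; omega
          · simp at h'
      · rw [decide_eq_false hm, if_neg (by simp), word, if_pos]
        push Not at hm
        obtain ⟨a, ha, hax⟩ := hm
        refine ⟨a, N, ?_, ?_, hpre a ha⟩
        · exact (List.singleton_sublist.mpr ha).append (List.Sublist.refl [N])
        · rcases hax.lt_or_eq with h | rfl
          · exact h
          · exact absurd rfl ((List.nodup_append.mp hnd).2.2 x ha x List.mem_cons_self)

lemma word_insert {pre xs ys : List ℕ} {N : ℕ} (hpre : ∀ a ∈ pre, a < N)
    (hxs : ∀ a ∈ xs, a < N) (hys : ∀ a ∈ ys, a < N) (hnd : (pre ++ xs ++ ys).Nodup)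
    (hlen : xs.length ≤ (word pre (xs ++ ys)).length) :
    word pre (xs ++ N :: ys) = wordStep (word pre (xs ++ ys)) xs.length := by
  induction xs generalizing pre with
  | nil => exact word_insert_head hpre hys (by simpa using hnd)
  | cons x xs ih =>
    rw [List.cons_append, word] at hlen ⊢
    by_cases h : Completes pre x
    · simp [h] at hlen
    · rw [if_neg h] at hlen
      rw [List.cons_append, word, if_neg h, if_neg h, List.length_cons, wordStep, ih]
      · intro a ha
        rcases List.mem_append.mp ha with ha | ha
        · exact hpre a ha
        · rw [List.mem_singleton.mp ha]; exact hxs x List.mem_cons_self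
      · exact fun a ha => hxs a (List.mem_cons_of_mem _ ha)
      · simpa using hnd
      · simpa using hlen

lemma has2314_insert {xs ys : List ℕ} {N : ℕ} (hxs : ∀ a ∈ xs, a < N) (hys : ∀ a ∈ ys, a < N) :
    Has2314 (xs ++ N :: ys) ↔ Has2314 (xs ++ ys) ∨ Has231 xs := by
  constructor
  · rintro ⟨a, b, c, d, h, h1, h2, h3⟩
    have hmem : ∀ z ∈ [b, c, a, d], z ≤ N := by
      intro z hz
      rcases List.mem_append.mp (h.subset hz) with h | h
      · exact (hxs z h).le
      · rcases List.mem_cons.mp h with rfl | h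
        · exact le_rfl
        · exact (hys z h).le
    have hd := hmem d (by simp)
    rw [List.sublist_append_iff] at h
    obtain ⟨l1, l2, e, s1, s2⟩ := h
    rcases List.sublist_cons_iff.mp s2 with h | ⟨r, rfl, h⟩
    · left; exact ⟨a, b, c, d, e ▸ s1.append h, h1, h2, h3⟩
    · right
      rcases l1 with _ | ⟨p, _ | ⟨q, _ | ⟨s, _ | ⟨t, l1⟩⟩⟩⟩
      · simp at e; omega
      · simp at e; omega
      · simp at e; omega
      · simp at e
        obtain ⟨rfl, rfl, rfl, rfl, rfl⟩ := e
        exact ⟨_, _, _, s1, h1, h2⟩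
      · simp at e
  · rintro (⟨a, b, c, d, h, h1, h2, h3⟩ | ⟨a, b, c, h, h1, h2⟩)
    · exact ⟨a, b, c, d, h.trans ((List.Sublist.refl xs).append (List.sublist_cons_self _ _)),
        h1, h2, h3⟩
    · exact ⟨a, b, c, N, h.append (List.singleton_sublist.mpr List.mem_cons_self), h1, h2,
        hxs c (h.subset (by simp))⟩

/-- Insertion of `N` at place `j`. -/
def insertAt (N : ℕ) (l : List ℕ) (j : ℕ) : List ℕ := l.take j ++ N :: l.drop j

/-- The `2314`-avoiding arrangements of `0, …, n - 1`. -/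
noncomputable def tree : ℕ → List (List ℕ)
  | 0 => [[]]
  | n + 1 => (tree n).flatMap fun l =>
      (List.range ((word [] l).length + 1)).map (insertAt n l)

lemma not_has231_nil : ¬ Has231 [] := by
  rintro ⟨a, b, c, h, -⟩; simp at h

lemma mem_tree {n : ℕ} {l : List ℕ} : l ∈ tree n ↔ l.Perm (List.range n) ∧ ¬ Has2314 l := by
  induction n generalizing l with
  | zero =>
    simp only [tree, List.mem_singleton, List.range_zero, List.perm_nil]
    constructor
    · rintro rfl
      refine ⟨rfl, ?_⟩
      rintro ⟨a, b, c, d, h, -⟩; simp at h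
    · exact fun h => h.1
  | succ n ih =>
    simp only [tree, List.mem_flatMap, List.mem_map, List.mem_range, Nat.lt_succ_iff]
    constructor
    · rintro ⟨l, hl, j, hj, rfl⟩
      obtain ⟨hp, hav⟩ := ih.mp hl
      have hlt : ∀ a ∈ l, a < n := fun a ha => List.mem_range.mp (hp.subset ha)
      have hjl := hj.trans (length_word_le [] l)
      refine ⟨?_, ?_⟩
      · rw [insertAt, List.range_succ]
        refine List.perm_middle.trans ?_
        rw [List.take_append_drop]
        exact (List.Perm.cons n hp).trans (List.perm_append_singleton n _).symm
      · rw [insertAt, has2314_insert (fun a ha => hlt a (List.mem_of_mem_take ha))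
          (fun a ha => hlt a (List.mem_of_mem_drop ha)), List.take_append_drop]
        have := (le_length_word_iff [] l not_has231_nil j hjl).mp hj
        simp only [List.nil_append] at this
        tauto
    · rintro ⟨hp, hav⟩
      obtain ⟨xs, ys, rfl⟩ := List.append_of_mem (hp.symm.subset (List.mem_range.mpr n.lt_succ_self))
      have hp' : (xs ++ ys).Perm (List.range n) := by
        have h := (List.perm_middle.symm.trans hp)
        rw [List.range_succ] at h
        exact (List.perm_cons n).mp (h.trans (List.perm_append_singleton n _))
      have hlt : ∀ a ∈ xs ++ ys, a < n := fun a ha => List.mem_range.mp (hp'.subset ha)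
      rw [has2314_insert (fun a ha => hlt a (List.mem_append_left _ ha))
        (fun a ha => hlt a (List.mem_append_right _ ha))] at hav
      push Not at hav
      refine ⟨xs ++ ys, ih.mpr ⟨hp', hav.1⟩, xs.length, ?_, ?_⟩
      · rw [le_length_word_iff [] _ not_has231_nil _ (by simp)]
        simpa using hav.2
      · simp [insertAt]

lemma nodup_tree (n : ℕ) : (tree n).Nodup := by
  induction n with
  | zero => simp [tree]
  | succ n ih =>
    rw [tree, List.nodup_flatMap]
    have hn : ∀ l ∈ tree n, n ∉ l := by
      intro l hl h
      have := List.mem_range.mp ((mem_tree.mp hl).1.subset h)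
      omega
    constructor
    · intro l hl
      refine List.Nodup.map_on ?_ List.nodup_range
      intro i hi j hj hij
      have key : ∀ i ∈ List.range ((word [] l).length + 1), (insertAt n l i).idxOf n = i := by
        intro i hi
        have : i ≤ l.length :=
          (Nat.lt_succ_iff.mp (List.mem_range.mp hi)).trans (length_word_le [] l)
        rw [insertAt, List.idxOf_append_of_notMem (fun h => hn l hl (List.mem_of_mem_take h))]
        simpa using this
      rw [← key i hi, ← key j hj, hij]
    · refine (List.Nodup.pairwise_of_forall_ne ih ?_)
      intro l hl l' hl' hne
      rw [Function.onFun, List.disjoint_left]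
      intro m hm hm'
      obtain ⟨i, -, rfl⟩ := List.mem_map.mp hm
      obtain ⟨j, -, hj⟩ := List.mem_map.mp hm'
      have key : ∀ l ∈ tree n, ∀ i, (insertAt n l i).erase n = l := by
        intro l hl i
        rw [insertAt, List.erase_append_right _ (fun h => hn l hl (List.mem_of_mem_take h))]
        simp
      exact hne (by rw [← key l hl i, ← key l' hl' j, hj])

lemma sum_tree {R : Type*} [CommRing R] (n : ℕ) (φ : List Bool → R) :
    ((tree n).map fun l => φ (word [] l)).sum = runSum n (fun s => φ (toWord s)) := by
  induction n generalizing φ with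
  | zero => simp [tree, runSum, word, toWord]
  | succ n ih =>
    rw [runSum]
    simp only [← wordSuccSum_toWord]
    rw [← ih (fun w => wordSuccSum w φ), tree, List.map_flatMap, List.flatMap, List.sum_flatten, List.map_map]
    congr 1
    refine List.map_congr_left fun l hl => ?_
    rw [← sum_wordStep, Function.comp_apply, List.map_map]
    congr 1
    refine List.map_congr_left fun j hj => ?_
    have hp := (mem_tree.mp hl).1
    have hlt : ∀ a ∈ l, a < n := fun a ha => List.mem_range.mp (hp.subset ha)
    have hj' := Nat.lt_succ_iff.mp (List.mem_range.mp hj)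
    have hjl := hj'.trans (length_word_le [] l)
    have h := word_insert (pre := []) (xs := l.take j) (ys := l.drop j) (N := n) (by simp)
      (fun a ha => hlt a (List.mem_of_mem_take ha)) (fun a ha => hlt a (List.mem_of_mem_drop ha))
      (by simpa using hp.symm.nodup List.nodup_range)
      (by simpa [hjl] using hj')
    simp only [List.take_append_drop, List.length_take, min_eq_left hjl] at h
    simp [insertAt, h]

theorem length_tree (n : ℕ) : ((tree n).length : ℚ) = runCount n := by
  have h := sum_tree n (fun _ => (1 : ℚ))
  simpa [runCount] using h

end StackMachine

/-- The pattern 1342 (0-indexed: 0,2,3,1). -/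
def pat1342 : Equiv.Perm (Fin 4) :=
  ⟨![0, 2, 3, 1], ![0, 3, 1, 2], by decide, by decide⟩

/-- The pattern 2314 (0-indexed: 1,2,0,3). -/
def pat2314 : Equiv.Perm (Fin 4) :=
  ⟨![1, 2, 0, 3], ![2, 0, 1, 3], by decide, by decide⟩

/-- The reverse-complement of the inverse of a permutation. -/
def revInvRev {n : ℕ} (p : Equiv.Perm (Fin n)) : Equiv.Perm (Fin n) :=
  Fin.revPerm * p⁻¹ * Fin.revPerm

lemma revInvRev_apply {n : ℕ} (p : Equiv.Perm (Fin n)) (i : Fin n) :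
    revInvRev p i = (p.symm i.rev).rev := rfl

lemma revInvRev_revInvRev {n : ℕ} (p : Equiv.Perm (Fin n)) : revInvRev (revInvRev p) = p := by
  have h : (Fin.revPerm : Equiv.Perm (Fin n))⁻¹ = Fin.revPerm := by ext; simp
  have h2 : (Fin.revPerm : Equiv.Perm (Fin n)) * Fin.revPerm = 1 := by ext; simp
  simp only [revInvRev, mul_inv_rev, inv_inv, h]
  simp only [mul_assoc, h2, mul_one]
  rw [← mul_assoc, h2, one_mul]

lemma PermContains.revInvRev {n k : ℕ} {p : Equiv.Perm (Fin n)} {q : Equiv.Perm (Fin k)}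
    (h : PermContains p q) : PermContains (revInvRev p) (revInvRev q) := by
  obtain ⟨f, hf, hpq⟩ := h
  refine ⟨fun i => (p (f (q.symm i.rev))).rev, fun i j hij => ?_, fun i j => ?_⟩
  · rw [Fin.rev_lt_rev, hpq]
    simpa using hij
  · simp only [revInvRev_apply, Fin.rev_rev, Equiv.symm_apply_apply, Fin.rev_lt_rev]
    exact hf.lt_iff_lt

lemma avoiders_revInvRev (n : ℕ) {k : ℕ} (q : Equiv.Perm (Fin k)) :
    avoiders n (revInvRev q) = avoiders n q := by
  refine Nat.card_congr
    { toFun := fun p => ⟨revInvRev p.1, fun h => p.2 ?_⟩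
      invFun := fun p => ⟨revInvRev p.1, fun h => p.2 ?_⟩
      left_inv := fun p => Subtype.ext (revInvRev_revInvRev p.1)
      right_inv := fun p => Subtype.ext (revInvRev_revInvRev p.1) }
  · have := h.revInvRev
    rwa [revInvRev_revInvRev] at this
  · have := h.revInvRev
    rwa [revInvRev_revInvRev, revInvRev_revInvRev] at this

/-- The list of values of a permutation. -/
def valueList {n : ℕ} (p : Equiv.Perm (Fin n)) : List ℕ := List.ofFn fun i => (p i : ℕ)

lemma valueList_injective {n : ℕ} : Function.Injective (valueList (n := n)) := by
  intro p q h
  ext i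
  exact congrFun (List.ofFn_injective h) i

lemma valueList_perm {n : ℕ} (p : Equiv.Perm (Fin n)) : (valueList p).Perm (List.range n) := by
  rw [List.perm_ext_iff_of_nodup]
  · intro a
    simp only [valueList, List.mem_ofFn, List.mem_range]
    constructor
    · rintro ⟨i, rfl⟩; exact (p i).2
    · intro h; exact ⟨p.symm ⟨a, h⟩, by simp⟩
  · exact List.nodup_ofFn.mpr fun i j h => p.injective (Fin.ext h)
  · exact List.nodup_range

lemma exists_valueList_eq {n : ℕ} {l : List ℕ} (h : l.Perm (List.range n)) :
    ∃ p : Equiv.Perm (Fin n), valueList p = l := by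
  have hlen : l.length = n := by simpa using h.length_eq
  subst hlen
  have hnd : l.Nodup := h.symm.nodup List.nodup_range
  have hlt : ∀ i : Fin l.length, l.get i < l.length := fun i =>
    List.mem_range.mp (h.subset (List.get_mem l i))
  have hinj : Function.Injective fun i : Fin l.length => (⟨l.get i, hlt i⟩ : Fin l.length) := by
    intro i j hij
    exact List.nodup_iff_injective_get.mp hnd (Fin.mk.inj hij)
  refine ⟨Equiv.ofBijective _ (Finite.injective_iff_bijective.mp hinj), ?_⟩
  simp only [valueList, Equiv.ofBijective_apply]
  exact List.ofFn_get l

lemma permContains_2314_iff {n : ℕ} (p : Equiv.Perm (Fin n)) :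
    PermContains p pat2314 ↔ StackMachine.Has2314 (valueList p) := by
  constructor
  · rintro ⟨f, hf, h⟩
    refine ⟨p (f 2), p (f 0), p (f 1), p (f 3), ?_, (h 2 0).mpr (by decide),
      (h 0 1).mpr (by decide), (h 1 3).mpr (by decide)⟩
    rw [List.sublist_iff_exists_fin_orderEmbedding_get_eq]
    refine ⟨OrderEmbedding.ofStrictMono
      (fun i => Fin.cast (by simp [valueList]) (f (Fin.cast (by simp) i))) ?_, ?_⟩
    · intro i j hij
      exact hf hij
    · intro i
      change Fin 4 at i
      fin_cases i <;> simp [valueList] <;> rfl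
  · rintro ⟨a, b, c, d, h, h1, h2, h3⟩
    rw [List.sublist_iff_exists_fin_orderEmbedding_get_eq] at h
    obtain ⟨f, hf⟩ := h
    have hl : (valueList p).length = n := by simp [valueList]
    let g : Fin 4 → Fin n := fun i => Fin.cast hl (f (Fin.cast (by simp) i))
    have hg : ∀ i : Fin 4, (p (g i) : ℕ) = [b, c, a, d].get (Fin.cast (by simp) i) := by
      intro i
      rw [hf]
      simp [g, valueList]
      rfl
    have g0 : (p (g 0) : ℕ) = b := hg 0
    have g1 : (p (g 1) : ℕ) = c := hg 1
    have g2 : (p (g 2) : ℕ) = a := hg 2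
    have g3 : (p (g 3) : ℕ) = d := hg 3
    refine ⟨g, fun i j hij => ?_, fun i j => ?_⟩
    · exact f.strictMono (a := Fin.cast (by simp) i) (b := Fin.cast (by simp) j) hij
    · rw [Fin.lt_def]
      fin_cases i <;> fin_cases j <;> simp [g0, g1, g2, g3, pat2314] <;> omega

lemma avoiders_2314 (n : ℕ) : avoiders n pat2314 = (StackMachine.tree n).length := by
  rw [← List.toFinset_card_of_nodup (StackMachine.nodup_tree n), ← Nat.card_eq_finsetCard]
  refine Nat.card_eq_of_bijective (fun p => ⟨valueList p.1, ?_⟩) ⟨?_, ?_⟩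
  · rw [List.mem_toFinset, StackMachine.mem_tree, ← permContains_2314_iff]
    exact ⟨valueList_perm p.1, p.2⟩
  · intro p q h
    exact Subtype.ext (valueList_injective (congrArg Subtype.val h))
  · rintro ⟨l, hl⟩
    rw [List.mem_toFinset, StackMachine.mem_tree] at hl
    obtain ⟨p, rfl⟩ := exists_valueList_eq hl.1
    exact ⟨⟨p, by rw [PermAvoids, permContains_2314_iff]; exact hl.2⟩, rfl⟩

theorem avoiders_1342 (n : ℕ) : (avoiders n pat1342 : ℚ) = StackMachine.runCount n := by
  have h : pat1342 = revInvRev pat2314 := by decide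
  rw [h, avoiders_revInvRev, avoiders_2314, StackMachine.length_tree]

theorem avoiders_1342_le (n : ℕ) : avoiders n pat1342 ≤ 8 ^ n := by
  have h := StackMachine.runCount_le n
  rw [← avoiders_1342] at h
  exact_mod_cast h

theorem le_avoiders_1342 (n : ℕ) :
    (8 : ℝ) ^ n / (16 * (n + 1) ^ 3) ≤ avoiders n pat1342 := by
  have h := StackMachine.le_runCount n
  rw [← avoiders_1342] at h
  have h' : (8 : ℚ) ^ n ≤ avoiders n pat1342 * (16 * (n + 1) ^ 3) :=
    (div_le_iff₀ (by positivity)).mp h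
  rw [div_le_iff₀ (by positivity)]
  exact_mod_cast h'

lemma permContains_12453_of_lt {n : ℕ} {p : Equiv.Perm (Fin n)} {x0 x1 x2 x3 x4 : Fin n}
    (h01 : x0 < x1) (h12 : x1 < x2) (h23 : x2 < x3) (h34 : x3 < x4)
    (v01 : p x0 < p x1) (v14 : p x1 < p x4) (v42 : p x4 < p x2) (v23 : p x2 < p x3) :
    PermContains p pat12453 := by
  refine ⟨![x0, x1, x2, x3, x4], ?_, ?_⟩
  · rw [Fin.strictMono_iff_lt_succ]
    intro i
    fin_cases i <;> simpa
  · intro i j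
    fin_cases i <;> fin_cases j <;> simp [pat12453] <;> order

/-- The positions of the left-to-right minima. -/
def leftMinima {n : ℕ} (p : Equiv.Perm (Fin n)) : Finset (Fin n) :=
  Finset.univ.filter fun i => ∀ j < i, p i < p j

lemma mem_leftMinima {n : ℕ} {p : Equiv.Perm (Fin n)} {i : Fin n} :
    i ∈ leftMinima p ↔ ∀ j < i, p i < p j := by
  simp [leftMinima]

section Fiber

variable {n m : ℕ} {u v : Finset (Fin n)}

/-- The standardization of the restriction of a permutation to the complement of `u`. -/
def standardize (hu : uᶜ.card = m) (hv : vᶜ.card = m) (p : Equiv.Perm (Fin n))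
    (h : ∀ a, a ∈ uᶜ ↔ p a ∈ vᶜ) : Equiv.Perm (Fin m) :=
  (uᶜ.orderIsoOfFin hu).toEquiv.trans ((p.subtypeEquiv h).trans (vᶜ.orderIsoOfFin hv).symm.toEquiv)

lemma orderIsoOfFin_standardize (hu : uᶜ.card = m) (hv : vᶜ.card = m) (p : Equiv.Perm (Fin n))
    (h : ∀ a, a ∈ uᶜ ↔ p a ∈ vᶜ) (i : Fin m) :
    ((vᶜ.orderIsoOfFin hv (standardize hu hv p h i) : _) : Fin n) =
      p (uᶜ.orderIsoOfFin hu i : _) := by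
  simp [standardize]

lemma standardize_avoids (hu : uᶜ.card = m) (hv : vᶜ.card = m) (p : Equiv.Perm (Fin n))
    (h : ∀ a, a ∈ uᶜ ↔ p a ∈ vᶜ) (hp : PermAvoids p pat12453) (hM : leftMinima p = u) :
    PermAvoids (standardize hu hv p h) pat1342 := by
  rintro ⟨f, hf, hσ⟩
  let g : Fin 4 → Fin n := fun i => (uᶜ.orderIsoOfFin hu (f i) : _)
  have hg : ∀ i j, i < j → g i < g j := fun i j hij =>
    (uᶜ.orderIsoOfFin hu).strictMono (hf hij)
  have hv : ∀ i j, pat1342 i < pat1342 j → p (g i) < p (g j) := by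
    intro i j hij
    have h1 := (vᶜ.orderIsoOfFin hv).strictMono ((hσ i j).mpr hij)
    have h2 : ((vᶜ.orderIsoOfFin hv (standardize hu hv p h (f i)) : _) : Fin n) <
      (vᶜ.orderIsoOfFin hv (standardize hu hv p h (f j)) : _) := h1
    rwa [orderIsoOfFin_standardize, orderIsoOfFin_standardize] at h2
  have h0 : g 0 ∉ leftMinima p := by
    rw [hM, ← Finset.mem_compl]
    exact (uᶜ.orderIsoOfFin hu (f 0)).2
  rw [mem_leftMinima] at h0
  push Not at h0
  obtain ⟨j, hj, hle⟩ := h0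
  have hlt : p j < p (g 0) := lt_of_le_of_ne hle fun h => hj.ne (p.injective h)
  exact hp (permContains_12453_of_lt hj (hg 0 1 (by decide)) (hg 1 2 (by decide))
    (hg 2 3 (by decide)) hlt (hv 0 3 (by decide)) (hv 3 1 (by decide)) (hv 1 2 (by decide)))

lemma apply_orderEmbOfFin_leftMinima {k : ℕ} (p : Equiv.Perm (Fin n)) (hM : leftMinima p = u)
    (hv : u.map p.toEmbedding = v) (huk : u.card = k) (hvk : v.card = k) (i : Fin k) :
    p (u.orderEmbOfFin huk i) = v.orderEmbOfFin hvk i.rev := by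
  have h := Finset.orderEmbOfFin_unique hvk (f := fun i => p (u.orderEmbOfFin huk i.rev)) ?_ ?_
  · have := congrFun h i.rev
    simpa using this
  · intro i
    rw [← hv]
    exact Finset.mem_map_of_mem _ (Finset.orderEmbOfFin_mem u huk _)
  · intro i j hij
    have h1 : u.orderEmbOfFin huk i.rev ∈ leftMinima p := by
      rw [hM]; exact Finset.orderEmbOfFin_mem u huk _
    refine mem_leftMinima.mp h1 _ ?_
    simpa using hij

lemma card_fiber_le (u v : Finset (Fin n)) :
    (Nat.card {p : Equiv.Perm (Fin n) // PermAvoids p pat12453 ∧ leftMinima p = u ∧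
      u.map p.toEmbedding = v} : ℝ) ≤ √8 ^ (n - u.card) * √8 ^ (n - v.card) := by
  rcases isEmpty_or_nonempty {p : Equiv.Perm (Fin n) // PermAvoids p pat12453 ∧ leftMinima p = u ∧
      u.map p.toEmbedding = v} with he | ⟨p0, -, -, hp0⟩
  · rw [Nat.card_of_isEmpty]; simp
  have huv : v.card = u.card := by rw [← hp0, Finset.card_map]
  have hu : uᶜ.card = n - u.card := by rw [Finset.card_compl, Fintype.card_fin]
  have hv : vᶜ.card = n - u.card := by rw [Finset.card_compl, Fintype.card_fin, huv]
  have hc : ∀ p : Equiv.Perm (Fin n), u.map p.toEmbedding = v → ∀ a, a ∈ uᶜ ↔ p a ∈ vᶜ := by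
    rintro p rfl a
    simp
  have hle : Nat.card {p : Equiv.Perm (Fin n) // PermAvoids p pat12453 ∧ leftMinima p = u ∧
      u.map p.toEmbedding = v} ≤ avoiders (n - u.card) pat1342 := by
    refine Nat.card_le_card_of_injective (fun p => ⟨standardize hu hv p.1 (hc p.1 p.2.2.2),
      standardize_avoids hu hv p.1 _ p.2.1 p.2.2.1⟩) ?_
    rintro ⟨p, hp, hp1, hp2⟩ ⟨q, hq, hq1, hq2⟩ hpq
    have hpq' := congrArg Subtype.val hpq
    apply Subtype.ext
    ext1 a
    by_cases ha : a ∈ u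
    · have : a ∈ Set.range (u.orderEmbOfFin rfl) := by
        rw [Finset.range_orderEmbOfFin]; exact ha
      obtain ⟨i, rfl⟩ := this
      exact (apply_orderEmbOfFin_leftMinima p hp1 hp2 rfl huv i).trans
        (apply_orderEmbOfFin_leftMinima q hq1 hq2 rfl huv i).symm
    · have ha' := Finset.mem_compl.mpr ha
      obtain ⟨i, hi⟩ := (uᶜ.orderIsoOfFin hu).surjective ⟨a, ha'⟩
      have h1 := orderIsoOfFin_standardize hu hv p (hc p hp2) i
      have h2 := orderIsoOfFin_standardize hu hv q (hc q hq2) i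
      rw [hi] at h1 h2
      change p a = q a
      rw [← h1, ← h2]
      change standardize hu hv p _ = standardize hu hv q _ at hpq'
      rw [hpq']
  have h8 : √8 ^ (n - u.card) * √8 ^ (n - v.card) = (8 : ℝ) ^ (n - u.card) := by
    rw [huv, ← mul_pow, Real.mul_self_sqrt (by norm_num)]
  rw [h8]
  exact_mod_cast hle.trans (avoiders_1342_le _)

end Fiber

theorem avoiders_12453_le (n : ℕ) : (avoiders n pat12453 : ℝ) ≤ ((1 + √8) ^ 2) ^ n := by
  classical
  let f : {p : Equiv.Perm (Fin n) // PermAvoids p pat12453} → Finset (Fin n) × Finset (Fin n) :=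
    fun p => (leftMinima p.1, (leftMinima p.1).map p.1.toEmbedding)
  have h1 : avoiders n pat12453 ≤ ∑ x : Finset (Fin n) × Finset (Fin n),
      Nat.card {p : Equiv.Perm (Fin n) // PermAvoids p pat12453 ∧ leftMinima p = x.1 ∧
        x.1.map p.toEmbedding = x.2} := by
    rw [avoiders, ← Nat.card_sigma]
    exact Nat.card_le_card_of_injective (fun p => ⟨f p, p.1, p.2, rfl, rfl⟩)
      fun p q h => Subtype.ext (congrArg (fun x => x.2.1) h)
  refine (Nat.cast_le.mpr h1).trans ?_
  push_cast
  calc _ ≤ ∑ x : Finset (Fin n) × Finset (Fin n), √8 ^ (n - x.1.card) * √8 ^ (n - x.2.card) :=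
        Finset.sum_le_sum fun x _ => card_fiber_le x.1 x.2
    _ = (∑ u : Finset (Fin n), √8 ^ (n - u.card)) * ∑ v : Finset (Fin n), √8 ^ (n - v.card) := by
        rw [Fintype.sum_prod_type, Finset.sum_mul_sum]
    _ = _ := by
        have := Fintype.sum_pow_mul_eq_add_pow (Fin n) (1 : ℝ) (√8)
        simp only [one_pow, one_mul, Fintype.card_fin] at this
        rw [this, ← pow_mul, mul_comm 2 n, pow_mul]
        ring

lemma equiv_eq_of_lt_iff {P Q : Type*} [LinearOrder Q] [WellFoundedLT Q] (e e' : P ≃ Q)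
    (h : ∀ a b, e a < e b ↔ e' a < e' b) : e = e' := by
  let f : Q ≃o Q :=
    { toEquiv := e.symm.trans e'
      map_rel_iff' := by
        intro a b
        rw [← not_lt, ← not_lt]
        simp [← h] }
  have hf : f = OrderIso.refl Q := Subsingleton.elim _ _
  ext a
  have := congrArg (fun g : Q ≃o Q => g (e a)) hf
  simpa [f] using this.symm

lemma exists_rank {P α : Type*} [Fintype P] [LinearOrder α] {x : P → α} {n : ℕ}
    (hx : Function.Injective x) (hn : Fintype.card P = n) :
    ∃ r : P ≃ Fin n, ∀ a b, r a < r b ↔ x a < x b := by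
  let _ : LinearOrder P := LinearOrder.lift' x hx
  exact ⟨(monoEquivOfFin P hn).symm.toEquiv, fun a b => (monoEquivOfFin P hn).symm.lt_iff_lt⟩

section Points

variable {P α β : Type*} [Fintype P] [LinearOrder α] [LinearOrder β] {n : ℕ}

/-- The permutation whose diagram is order-isomorphic to the points with coordinates `x`, `y`. -/
noncomputable def permOfPoints {x : P → α} {y : P → β} (hx : Function.Injective x)
    (hy : Function.Injective y) (hn : Fintype.card P = n) : Equiv.Perm (Fin n) :=
  (exists_rank hx hn).choose.symm.trans (exists_rank hy hn).choose

variable {x x' : P → α} {y y' : P → β} (hx : Function.Injective x) (hy : Function.Injective y)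
  (hx' : Function.Injective x') (hy' : Function.Injective y') (hn : Fintype.card P = n)

lemma exists_points_of_permContains {k : ℕ} {q : Equiv.Perm (Fin k)}
    (h : PermContains (permOfPoints hx hy hn) q) : ∃ g : Fin k → P,
      (∀ a b, x (g a) < x (g b) ↔ a < b) ∧ ∀ a b, y (g a) < y (g b) ↔ q a < q b := by
  obtain ⟨f, hf, hq⟩ := h
  refine ⟨fun i => (exists_rank hx hn).choose.symm (f i), fun a b => ?_, fun a b => ?_⟩
  · rw [← (exists_rank hx hn).choose_spec]
    simpa using hf.lt_iff_lt
  · rw [← (exists_rank hy hn).choose_spec]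
    exact hq a b

lemma exists_equiv_of_permOfPoints_eq
    (h : permOfPoints hx hy hn = permOfPoints hx' hy' hn) : ∃ θ : P ≃ P,
      (∀ a b, x' (θ a) < x' (θ b) ↔ x a < x b) ∧ ∀ a b, y' (θ a) < y' (θ b) ↔ y a < y b := by
  refine ⟨(exists_rank hx hn).choose.trans (exists_rank hx' hn).choose.symm,
    fun a b => ?_, fun a b => ?_⟩
  · rw [← (exists_rank hx hn).choose_spec, ← (exists_rank hx' hn).choose_spec]
    simp
  · rw [← (exists_rank hy hn).choose_spec, ← (exists_rank hy' hn).choose_spec]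
    have key : ∀ a, (exists_rank hy' hn).choose
        (((exists_rank hx hn).choose.trans (exists_rank hx' hn).choose.symm) a) =
          (exists_rank hy hn).choose a := by
      intro a
      have := congrArg (fun p => p ((exists_rank hx hn).choose a)) h
      simp only [permOfPoints, Equiv.trans_apply, Equiv.symm_apply_apply] at this
      exact this.symm
    rw [key, key]

end Points

section Shuffle

variable {t s : ℕ}

/-- The shuffle of two chains prescribed by the set of positions of the first one. -/
def shuffle (u : {u : Finset (Fin (t + s)) // u.card = t}) : Fin t ⊕ Fin s ≃ Fin (t + s) :=
  finSumEquivOfFinset u.2 (by rw [Finset.card_compl, Fintype.card_fin, u.2]; omega)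

lemma shuffle_inl_lt (u : {u : Finset (Fin (t + s)) // u.card = t}) {a b : Fin t} :
    shuffle u (Sum.inl a) < shuffle u (Sum.inl b) ↔ a < b := by
  simp [shuffle]

lemma shuffle_inr_lt (u : {u : Finset (Fin (t + s)) // u.card = t}) {a b : Fin s} :
    shuffle u (Sum.inr a) < shuffle u (Sum.inr b) ↔ a < b := by
  simp [shuffle]

lemma shuffle_ext (u u' : {u : Finset (Fin (t + s)) // u.card = t})
    (h : ∀ a b, shuffle u (Sum.inl a) < shuffle u (Sum.inr b) ↔
      shuffle u' (Sum.inl a) < shuffle u' (Sum.inr b)) : u = u' := by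
  have hne : ∀ (u : {u : Finset (Fin (t + s)) // u.card = t}) a b,
      shuffle u (Sum.inr b) < shuffle u (Sum.inl a) ↔
        ¬ shuffle u (Sum.inl a) < shuffle u (Sum.inr b) := by
    intro u a b
    rw [not_lt, le_iff_lt_or_eq, or_iff_left]
    intro h
    have := (shuffle u).injective h
    simp at this
  have he : shuffle u = shuffle u' := by
    apply equiv_eq_of_lt_iff
    rintro (a | a) (b | b)
    · rw [shuffle_inl_lt, shuffle_inl_lt]
    · exact h a b
    · rw [hne, hne, h]
    · rw [shuffle_inr_lt, shuffle_inr_lt]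
  have hmem : ∀ (u : {u : Finset (Fin (t + s)) // u.card = t}) z,
      z ∈ u.1 ↔ ∃ a, shuffle u (Sum.inl a) = z := by
    intro u z
    have := Finset.range_orderEmbOfFin u.1 u.2
    rw [← Finset.mem_coe, ← this]
    rfl
  apply Subtype.ext
  ext1 z
  rw [hmem, hmem, he]

end Shuffle

section Inflation

variable (r t s e : ℕ)

/-- A choice, for each of `r` blocks, of two shuffles with chains of `t` points and of a
1342-avoiding permutation. -/
abbrev BlockData : Type :=
  Fin r → {u : Finset (Fin (t + s)) // u.card = t} × {v : Finset (Fin (t + s)) // v.card = t} ×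
    {σ : Equiv.Perm (Fin s) // PermAvoids σ pat1342}

/-- A decreasing sequence of minima, followed by the points of the `r` blocks. -/
abbrev BlockPoint : Type := Fin ((r + 2) * t + e) ⊕ (Fin r × Fin s)

variable {r t s e}

/-- Horizontal offset of the `l`-th point of the `j`-th chain of minima. -/
def xOffset (d : BlockData r t s) (j l : ℕ) : ℕ :=
  if h : 2 ≤ j ∧ j < r + 2 ∧ l < t then
    (shuffle (d ⟨j - 2, by omega⟩).1 (Sum.inl ⟨l, h.2.2⟩)).val else l

/-- Vertical offset of the `l`-th point of the `j`-th chain of minima. -/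
def yOffset (d : BlockData r t s) (j l : ℕ) : ℕ :=
  if h : j < r ∧ l < t then
    (shuffle (d ⟨j, h.1⟩).2.1 (Sum.inl (Fin.rev ⟨l, h.2⟩))).val else t - l

/-- Horizontal coordinate. -/
def xCoord (d : BlockData r t s) : BlockPoint r t s e → ℕ ×ₗ ℕ
  | Sum.inl m => toLex (m / t + 1, xOffset d (m / t) (m % t))
  | Sum.inr p => toLex (p.1 + 3, (shuffle (d p.1).1 (Sum.inr p.2)).val)

/-- Vertical coordinate. -/
def yCoord (d : BlockData r t s) : BlockPoint r t s e → ℤ ×ₗ ℕ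
  | Sum.inl m => toLex (-((m / t : ℕ) : ℤ) - 1, yOffset d (m / t) (m % t))
  | Sum.inr p => toLex (-(p.1 : ℤ) - 1, (shuffle (d p.1).2.1 (Sum.inr ((d p.1).2.2.1 p.2))).val)

variable (d : BlockData r t s)

lemma xOffset_lt {j l l' : ℕ} (h : l < l') (h' : l' < t) : xOffset d j l < xOffset d j l' := by
  unfold xOffset
  by_cases hj : 2 ≤ j ∧ j < r + 2
  · rw [dif_pos ⟨hj.1, hj.2, h.trans h'⟩, dif_pos ⟨hj.1, hj.2, h'⟩, Fin.val_fin_lt,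
      shuffle_inl_lt]
    exact h
  · rw [dif_neg (fun H => hj ⟨H.1, H.2.1⟩), dif_neg (fun H => hj ⟨H.1, H.2.1⟩)]
    exact h

lemma yOffset_lt {j l l' : ℕ} (h : l < l') (h' : l' < t) : yOffset d j l' < yOffset d j l := by
  unfold yOffset
  by_cases hj : j < r
  · rw [dif_pos ⟨hj, h'⟩, dif_pos ⟨hj, h.trans h'⟩, Fin.val_fin_lt, shuffle_inl_lt, Fin.rev_lt_rev]
    exact h
  · rw [dif_neg (fun H => hj H.1), dif_neg (fun H => hj H.1)]
    omega

lemma xCoord_inl_lt (ht : 0 < t) (m m' : Fin ((r + 2) * t + e)) :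
    xCoord d (Sum.inl m : BlockPoint r t s e) < xCoord d (Sum.inl m') ↔ m < m' := by
  have key : ∀ m m' : Fin ((r + 2) * t + e), m < m' →
      xCoord d (Sum.inl m : BlockPoint r t s e) < xCoord d (Sum.inl m') := by
    intro m m' h
    have h' : m.val < m'.val := h
    simp only [xCoord, Prod.Lex.toLex_lt_toLex]
    rcases (Nat.div_le_div_right h'.le : m.val / t ≤ m'.val / t).lt_or_eq with hd | hd
    · left; omega
    · right
      refine ⟨by omega, ?_⟩
      rw [hd]
      apply xOffset_lt _ _ (Nat.mod_lt _ ht)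
      have h1 := Nat.div_add_mod m.val t
      have h2 := Nat.div_add_mod m'.val t
      rw [hd] at h1
      omega
  refine ⟨fun h => ?_, key m m'⟩
  by_contra hc
  rcases (not_lt.1 hc).lt_or_eq with hc | rfl
  · exact lt_asymm h (key _ _ hc)
  · exact lt_irrefl _ h

lemma yCoord_inl_lt (ht : 0 < t) (m m' : Fin ((r + 2) * t + e)) :
    yCoord d (Sum.inl m : BlockPoint r t s e) < yCoord d (Sum.inl m') ↔ m' < m := by
  have key : ∀ m m' : Fin ((r + 2) * t + e), m' < m →
      yCoord d (Sum.inl m : BlockPoint r t s e) < yCoord d (Sum.inl m') := by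
    intro m m' h
    have h' : m'.val < m.val := h
    simp only [yCoord, Prod.Lex.toLex_lt_toLex]
    rcases (Nat.div_le_div_right h'.le : m'.val / t ≤ m.val / t).lt_or_eq with hd | hd
    · left; omega
    · right
      refine ⟨by omega, ?_⟩
      rw [hd]
      apply yOffset_lt _ _ (Nat.mod_lt _ ht)
      have h1 := Nat.div_add_mod m.val t
      have h2 := Nat.div_add_mod m'.val t
      rw [← hd] at h1
      omega
  refine ⟨fun h => ?_, key m m'⟩
  by_contra hc
  rcases (not_lt.1 hc).lt_or_eq with hc | rfl
  · exact lt_asymm h (key _ _ hc)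
  · exact lt_irrefl _ h

lemma xCoord_inr_lt (i i' : Fin r) (a a' : Fin s) :
    xCoord d (Sum.inr (i, a) : BlockPoint r t s e) < xCoord d (Sum.inr (i', a') : BlockPoint r t s e) ↔
      i < i' ∨ i = i' ∧ a < a' := by
  simp only [xCoord, Prod.Lex.toLex_lt_toLex]
  refine or_congr (by rw [Fin.lt_def]; omega) ⟨?_, ?_⟩
  · rintro ⟨h, h'⟩
    obtain rfl : i = i' := Fin.ext (by omega)
    exact ⟨rfl, by rwa [Fin.val_fin_lt, shuffle_inr_lt] at h'⟩
  · rintro ⟨rfl, h'⟩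
    exact ⟨rfl, by rwa [Fin.val_fin_lt, shuffle_inr_lt]⟩

lemma yCoord_inr_lt (i i' : Fin r) (a a' : Fin s) :
    yCoord d (Sum.inr (i, a) : BlockPoint r t s e) < yCoord d (Sum.inr (i', a') : BlockPoint r t s e) ↔
      i' < i ∨ i = i' ∧ (d i).2.2.1 a < (d i).2.2.1 a' := by
  simp only [yCoord, Prod.Lex.toLex_lt_toLex]
  refine or_congr (by rw [Fin.lt_def]; omega) ⟨?_, ?_⟩
  · rintro ⟨h, h'⟩
    obtain rfl : i = i' := Fin.ext (by omega)
    exact ⟨rfl, by rwa [Fin.val_fin_lt, shuffle_inr_lt] at h'⟩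
  · rintro ⟨rfl, h'⟩
    exact ⟨rfl, by rwa [Fin.val_fin_lt, shuffle_inr_lt]⟩

lemma xCoord_inl_ne_inr (ht : 0 < t) (m : Fin ((r + 2) * t + e)) (p : Fin r × Fin s) :
    xCoord d (Sum.inl m : BlockPoint r t s e) ≠ xCoord d (Sum.inr p : BlockPoint r t s e) := by
  obtain ⟨i, a⟩ := p
  intro h
  simp only [xCoord, toLex_inj, Prod.mk.injEq] at h
  obtain ⟨h1, h2⟩ := h
  have hi := i.2
  have hj : m.val / t - 2 = i.val := by omega
  rw [xOffset, dif_pos ⟨by omega, by omega, Nat.mod_lt _ ht⟩] at h2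
  simp only [hj, Fin.eta] at h2
  have := (shuffle _).injective (Fin.ext h2)
  simp at this

lemma yCoord_inl_ne_inr (ht : 0 < t) (m : Fin ((r + 2) * t + e)) (p : Fin r × Fin s) :
    yCoord d (Sum.inl m : BlockPoint r t s e) ≠ yCoord d (Sum.inr p : BlockPoint r t s e) := by
  obtain ⟨i, a⟩ := p
  intro h
  simp only [yCoord, toLex_inj, Prod.mk.injEq] at h
  obtain ⟨h1, h2⟩ := h
  have hi := i.2
  have hj : m.val / t = i.val := by omega
  rw [yOffset, dif_pos ⟨by omega, Nat.mod_lt _ ht⟩] at h2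
  simp only [hj, Fin.eta] at h2
  have := (shuffle _).injective (Fin.ext h2)
  simp at this

lemma xCoord_injective (ht : 0 < t) :
    Function.Injective (xCoord d : BlockPoint r t s e → ℕ ×ₗ ℕ) := by
  rintro (m | ⟨i, a⟩) (m' | ⟨i', a'⟩) h
  · have h1 := (xCoord_inl_lt d ht m m').not.1 h.not_lt
    have h2 := (xCoord_inl_lt d ht m' m).not.1 h.symm.not_lt
    rw [le_antisymm (not_lt.1 h2) (not_lt.1 h1)]
  · exact absurd h (xCoord_inl_ne_inr d ht _ _)
  · exact absurd h.symm (xCoord_inl_ne_inr d ht _ _)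
  · have h1 := (xCoord_inr_lt (e := e) d i i' a a').not.1 h.not_lt
    have h2 := (xCoord_inr_lt (e := e) d i' i a' a).not.1 h.symm.not_lt
    obtain rfl : i = i' := by
      by_contra hne
      rcases lt_or_gt_of_ne hne with hlt | hlt
      · exact h1 (Or.inl hlt)
      · exact h2 (Or.inl hlt)
    have h3 : ¬ a < a' := fun hlt => h1 (Or.inr ⟨rfl, hlt⟩)
    have h4 : ¬ a' < a := fun hlt => h2 (Or.inr ⟨rfl, hlt⟩)
    rw [le_antisymm (not_lt.1 h4) (not_lt.1 h3)]

lemma yCoord_injective (ht : 0 < t) :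
    Function.Injective (yCoord d : BlockPoint r t s e → ℤ ×ₗ ℕ) := by
  rintro (m | ⟨i, a⟩) (m' | ⟨i', a'⟩) h
  · have h1 := (yCoord_inl_lt d ht m m').not.1 h.not_lt
    have h2 := (yCoord_inl_lt d ht m' m).not.1 h.symm.not_lt
    rw [le_antisymm (not_lt.1 h1) (not_lt.1 h2)]
  · exact absurd h (yCoord_inl_ne_inr d ht _ _)
  · exact absurd h.symm (yCoord_inl_ne_inr d ht _ _)
  · have h1 := (yCoord_inr_lt (e := e) d i i' a a').not.1 h.not_lt
    have h2 := (yCoord_inr_lt (e := e) d i' i a' a).not.1 h.symm.not_lt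
    obtain rfl : i = i' := by
      by_contra hne
      rcases lt_or_gt_of_ne hne with hlt | hlt
      · exact h2 (Or.inl hlt)
      · exact h1 (Or.inl hlt)
    have h3 : ¬ (d i).2.2.1 a < (d i).2.2.1 a' := fun hlt => h1 (Or.inr ⟨rfl, hlt⟩)
    have h4 : ¬ (d i).2.2.1 a' < (d i).2.2.1 a := fun hlt => h2 (Or.inr ⟨rfl, hlt⟩)
    rw [(d i).2.2.1.injective (le_antisymm (not_lt.1 h4) (not_lt.1 h3))]

lemma exists_below_iff (ht : 0 < t) (p : BlockPoint r t s e) :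
    (∃ q : BlockPoint r t s e, xCoord d q < xCoord d p ∧ yCoord d q < yCoord d p) ↔ p.isRight := by
  rcases p with m | ⟨i, a⟩
  · simp only [Sum.isRight_inl, Bool.false_eq_true, iff_false]
    rintro ⟨m' | ⟨i, a⟩, hx, hy⟩
    · rw [xCoord_inl_lt d ht] at hx
      rw [yCoord_inl_lt d ht] at hy
      exact lt_asymm hx hy
    · simp only [xCoord, yCoord, Prod.Lex.toLex_lt_toLex] at hx hy
      omega
  · simp only [Sum.isRight_inr, iff_true]
    have hi := i.2
    have hlt : (i.val + 1) * t < (r + 2) * t + e := by nlinarith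
    refine ⟨Sum.inl ⟨(i.val + 1) * t, hlt⟩, ?_, ?_⟩
    · simp only [xCoord, Prod.Lex.toLex_lt_toLex, Nat.mul_div_cancel _ ht]
      left; omega
    · simp only [yCoord, Prod.Lex.toLex_lt_toLex, Nat.mul_div_cancel _ ht]
      left; omega

/-- The permutation with the prescribed blocks. -/
noncomputable def inflation (ht : 0 < t) (d : BlockData r t s) (e : ℕ) :
    Equiv.Perm (Fin ((r + 2) * t + e + r * s)) :=
  permOfPoints (xCoord_injective (e := e) d ht) (yCoord_injective d ht) (by simp)

lemma inflation_avoids (ht : 0 < t) : PermAvoids (inflation ht d e) pat12453 := by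
  intro h
  obtain ⟨g, hx, hy⟩ := exists_points_of_permContains _ _ _ h
  have hr : ∀ k : Fin 4, ∃ i a, g k.succ = Sum.inr (i, a) := by
    intro k
    have : (g k.succ).isRight := by
      rw [← exists_below_iff d ht]
      refine ⟨g 0, (hx _ _).2 k.succ_pos, (hy _ _).2 ?_⟩
      revert k
      decide
    obtain ⟨⟨i, a⟩, h⟩ := Sum.isRight_iff.1 this
    exact ⟨i, a, h⟩
  choose i a hg using hr
  have hx' := fun k k' : Fin 4 => hx k.succ k'.succ
  have hy' := fun k k' : Fin 4 => hy k.succ k'.succ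
  simp only [hg, xCoord_inr_lt, yCoord_inr_lt, Fin.succ_lt_succ_iff] at hx' hy'
  have hi : ∀ k, i k = i 0 := by
    intro k
    by_cases hk : k = 0
    · rw [hk]
    have h1 := (hx' 0 k).2 (Fin.pos_of_ne_zero hk)
    have h2 := (hy' 0 k).2 (by clear * - hk; revert k; decide)
    rcases h1 with h1 | h1
    · rcases h2 with h2 | h2
      · exact absurd h2 (lt_asymm h1)
      · exact h2.1.symm
    · exact h1.1.symm
  simp only [hi, lt_irrefl, false_or, true_and] at hx' hy'
  refine (d (i 0)).2.2.2 ⟨a, fun k k' h => (hx' k k').2 h, fun k k' => ?_⟩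
  rw [hy']
  revert k k'
  decide

lemma inflation_injective (ht : 0 < t) :
    Function.Injective fun d : BlockData r t s => inflation ht d e := by
  intro d d' h
  obtain ⟨θ, hX, hY⟩ := exists_equiv_of_permOfPoints_eq _ _ _ _ _ h
  have hright : ∀ p, (θ p).isRight = p.isRight := by
    intro p
    rw [Bool.eq_iff_iff, ← exists_below_iff d' ht, ← exists_below_iff d ht, ← θ.exists_congr_right]
    simp only [hX, hY]
  let κ : BlockPoint r t s e ≃ Lex (Fin ((r + 2) * t + e) ⊕ Lex (Fin r × Fin s)) :=
    (Equiv.sumCongr (Equiv.refl _) toLex).trans toLex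
  have hκ : ∀ (d : BlockData r t s) (p q : BlockPoint r t s e), κ p < κ q ↔
      (p.isRight = false ∧ q.isRight = true) ∨ (p.isRight = q.isRight ∧
        xCoord d p < xCoord d q) := by
    rintro d (m | ⟨i, a⟩) (m' | ⟨i', a'⟩)
    · simp [κ, xCoord_inl_lt d ht]
    · simp [κ]
    · simp [κ]
    · simp [κ, xCoord_inr_lt, Prod.Lex.toLex_lt_toLex]
  have hθ : θ.trans κ = κ := by
    apply equiv_eq_of_lt_iff
    intro p q
    simp only [Equiv.trans_apply]
    rw [hκ d' (θ p) (θ q), hκ d p q, hright, hright, hX]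
  have hθ' : ∀ p, θ p = p := fun p => κ.injective (congrArg (fun f => f p) hθ)
  simp only [hθ'] at hX hY
  funext i
  have hi := i.2
  have hσ : (d i).2.2 = (d' i).2.2 := by
    apply Subtype.ext
    apply equiv_eq_of_lt_iff
    intro a b
    have := hY (Sum.inr (i, a)) (Sum.inr (i, b))
    simp only [yCoord_inr_lt, lt_irrefl, false_or, true_and] at this
    exact this.symm
  refine Prod.ext ?_ (Prod.ext ?_ hσ)
  · apply shuffle_ext
    intro l b
    have hlt : (i.val + 2) * t + l.val < (r + 2) * t + e := by nlinarith [l.2]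
    have := hX (Sum.inl ⟨(i.val + 2) * t + l.val, hlt⟩) (Sum.inr (i, b))
    have h1 : ((i.val + 2) * t + l.val) / t = i.val + 2 := by
      rw [add_comm, Nat.add_mul_div_right _ _ ht, Nat.div_eq_of_lt l.2, zero_add]
    have h2 : ((i.val + 2) * t + l.val) % t = l.val := by
      rw [add_comm, Nat.add_mul_mod_self_right, Nat.mod_eq_of_lt l.2]
    simp only [xCoord, Prod.Lex.toLex_lt_toLex, h1, h2, xOffset] at this
    simpa [hi] using this.symm
  · apply shuffle_ext
    intro l b
    obtain ⟨b, rfl⟩ := (d i).2.2.1.surjective b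
    have hlt : i.val * t + l.rev.val < (r + 2) * t + e := by nlinarith [l.rev.2]
    have := hY (Sum.inl ⟨i.val * t + l.rev.val, hlt⟩) (Sum.inr (i, b))
    have h1 : (i.val * t + l.rev.val) / t = i.val := by
      rw [add_comm, Nat.add_mul_div_right _ _ ht, Nat.div_eq_of_lt l.rev.2, zero_add]
    have h2 : (i.val * t + l.rev.val) % t = l.rev.val := by
      rw [add_comm, Nat.add_mul_mod_self_right, Nat.mod_eq_of_lt l.rev.2]
    simp only [yCoord, Prod.Lex.toLex_lt_toLex, h1, h2, yOffset] at this
    simp only [Fin.is_lt, and_self, ↓reduceDIte, lt_irrefl, Fin.eta, Fin.rev_rev, true_and,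
      false_or, Fin.val_fin_lt, ← hσ] at this
    exact this.symm

theorem pow_le_avoiders_12453 (ht : 0 < t) (r s e : ℕ) :
    ((t + s).choose t ^ 2 * avoiders s pat1342) ^ r ≤
      avoiders ((r + 2) * t + e + r * s) pat12453 := by
  have h := Nat.card_le_card_of_injective
    (fun d : BlockData r t s => (⟨inflation ht d e, inflation_avoids d ht⟩ :
      {p : Equiv.Perm (Fin ((r + 2) * t + e + r * s)) // PermAvoids p pat12453}))
    (fun d d' h => inflation_injective ht (Subtype.ext_iff.1 h))
  refine le_trans (le_of_eq ?_) h
  have hc : Nat.card {u : Finset (Fin (t + s)) // u.card = t} = (t + s).choose t := by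
    simp
  rw [Nat.card_fun, Nat.card_prod, Nat.card_prod, hc, Nat.card_fin, avoiders]
  ring

end Inflation

lemma exists_pow_le_choose_sq_mul_avoiders :
    ∃ t s : ℕ, 0 < t ∧
      (14.2 : ℝ) ^ (t + s) ≤ (t + s).choose t ^ 2 * avoiders s pat1342 := by
  have hlim : Filter.Tendsto (fun n : ℕ => (n : ℝ) ^ 5 * (14.2 / 14.5924) ^ n) Filter.atTop
      (nhds 0) :=
    tendsto_pow_const_mul_const_pow_of_abs_lt_one 5 (by rw [abs_lt]; constructor <;> norm_num)
  obtain ⟨N, hN1, hN⟩ := ((hlim.eventually_le_const (by norm_num : (0 : ℝ) < 1 / 512)).and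
    (Filter.eventually_gt_atTop 0)).exists
  have hpoly : 16 * ((N : ℝ) + 1) ^ 5 * 14.2 ^ N ≤ 14.5924 ^ N := by
    rw [div_pow, mul_div_assoc', div_le_iff₀ (by positivity)] at hN1
    have h1 : (1 : ℝ) ≤ N := by exact_mod_cast hN
    have h2 : ((N : ℝ) + 1) ^ 5 ≤ (2 * N) ^ 5 := by gcongr; linarith
    have h3 : ((N : ℝ) + 1) ^ 5 * 14.2 ^ N ≤ (2 * N) ^ 5 * 14.2 ^ N := by gcongr
    nlinarith
  obtain ⟨t, ht, hsum⟩ : ∃ t ∈ Finset.range (N + 1),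
      (3.82 : ℝ) ^ N / (N + 1) ≤ 1 ^ t * 2.82 ^ (N - t) * N.choose t := by
    apply Finset.exists_le_of_sum_le ⟨0, by simp⟩
    rw [← add_pow, Finset.sum_const, Finset.card_range, nsmul_eq_mul]
    push_cast
    rw [mul_div_cancel₀ _ (by positivity)]
    norm_num
  obtain ⟨s, rfl⟩ := Nat.exists_eq_add_of_le (Nat.lt_succ_iff.1 (Finset.mem_range.1 ht))
  rw [Nat.add_sub_cancel_left, one_pow, one_mul, div_le_iff₀ (by positivity)] at hsum
  have havoid := le_avoiders_1342 s
  rw [div_le_iff₀ (by positivity)] at havoid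
  have hsq : (14.5924 : ℝ) ^ (t + s) ≤
      8 ^ s * (t + s).choose t ^ 2 * (((t + s : ℕ) : ℝ) + 1) ^ 2 := by
    calc (14.5924 : ℝ) ^ (t + s) = (3.82 ^ (t + s)) ^ 2 := by
          rw [← pow_mul, mul_comm (t + s), pow_mul]; norm_num
      _ ≤ (2.82 ^ s * (t + s).choose t * (((t + s : ℕ) : ℝ) + 1)) ^ 2 := by gcongr
      _ = (2.82 ^ 2) ^ s * (t + s).choose t ^ 2 * (((t + s : ℕ) : ℝ) + 1) ^ 2 := by
          rw [mul_pow, mul_pow, pow_right_comm]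
      _ ≤ _ := by gcongr; norm_num
  have hmain : (14.2 : ℝ) ^ (t + s) ≤ (t + s).choose t ^ 2 * avoiders s pat1342 := by
    have hs : ((s : ℝ) + 1) ≤ ((t + s : ℕ) : ℝ) + 1 := by
      push_cast
      linarith [t.cast_nonneg (α := ℝ)]
    have hpos : (0 : ℝ) < 16 * (((t + s : ℕ) : ℝ) + 1) ^ 5 := by positivity
    refine le_of_mul_le_mul_left (hpoly.trans (hsq.trans ?_)) hpos
    calc (8 : ℝ) ^ s * (t + s).choose t ^ 2 * (((t + s : ℕ) : ℝ) + 1) ^ 2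
        ≤ (avoiders s pat1342 * (16 * ((s : ℝ) + 1) ^ 3)) * (t + s).choose t ^ 2 *
            (((t + s : ℕ) : ℝ) + 1) ^ 2 := by gcongr
      _ ≤ (avoiders s pat1342 * (16 * (((t + s : ℕ) : ℝ) + 1) ^ 3)) * (t + s).choose t ^ 2 *
            (((t + s : ℕ) : ℝ) + 1) ^ 2 := by gcongr
      _ = _ := by ring
  refine ⟨t, s, Nat.pos_of_ne_zero ?_, hmain⟩
  rintro rfl
  have h8 : (avoiders s pat1342 : ℝ) ≤ 8 ^ s := by exact_mod_cast avoiders_1342_le s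
  simp only [zero_add, Nat.choose_zero_right, Nat.cast_one, one_pow, one_mul] at hmain hN
  have : (8 : ℝ) ^ s < 14.2 ^ s := pow_lt_pow_left₀ (by norm_num) (by norm_num) hN.ne'
  linarith

lemma exists_mul_pow_le_avoiders_12453 :
    ∃ c : ℝ, 0 < c ∧ ∀ᶠ n : ℕ in Filter.atTop, c * 14.2 ^ n ≤ avoiders n pat12453 := by
  obtain ⟨t, s, ht, hK⟩ := exists_pow_le_choose_sq_mul_avoiders
  refine ⟨(14.2 ^ (2 * t + (t + s)))⁻¹, by positivity, ?_⟩
  filter_upwards [Filter.eventually_ge_atTop (2 * t)] with n hn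
  obtain ⟨m, rfl⟩ := Nat.exists_eq_add_of_le hn
  have hdiv := Nat.div_add_mod m (t + s)
  have hmod := Nat.mod_lt m (by omega : 0 < t + s)
  set r := m / (t + s)
  set e := m % (t + s)
  have hn' : 2 * t + m = (r + 2) * t + e + r * s := by rw [← hdiv]; ring
  have h : ((((t + s).choose t ^ 2 * avoiders s pat1342) ^ r : ℕ) : ℝ) ≤
      avoiders (2 * t + m) pat12453 := by
    rw [hn']
    exact_mod_cast pow_le_avoiders_12453 ht r s e
  refine le_trans ?_ h
  push_cast
  calc (14.2 ^ (2 * t + (t + s)))⁻¹ * (14.2 : ℝ) ^ (2 * t + m)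
      ≤ (14.2 ^ (2 * t + (t + s)))⁻¹ * (14.2 : ℝ) ^ (2 * t + (t + s) + (t + s) * r) := by
        refine mul_le_mul_of_nonneg_left (pow_le_pow_right₀ (by norm_num) ?_) (by positivity)
        linarith
    _ = ((14.2 : ℝ) ^ (t + s)) ^ r := by
        rw [pow_add _ (2 * t + (t + s)), pow_mul _ (t + s), inv_mul_cancel_left₀ (by positivity)]
    _ ≤ _ := by gcongr

lemma eventually_le_root_avoiders_12453 : ∀ᶠ n : ℕ in Filter.atTop,
    14.12 ≤ (avoiders n pat12453 : ℝ) ^ (1 / (n : ℝ)) := by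
  obtain ⟨c, hc, h⟩ := exists_mul_pow_le_avoiders_12453
  have hlim : Filter.Tendsto (fun n : ℕ => ((14.12 : ℝ) / 14.2) ^ n) Filter.atTop (nhds 0) :=
    tendsto_pow_atTop_nhds_zero_of_lt_one (by norm_num) (by norm_num)
  filter_upwards [h, hlim.eventually_le_const hc, Filter.eventually_ne_atTop 0] with n h1 h2 hn
  rw [div_pow, div_le_iff₀ (by positivity)] at h2
  rw [one_div, ← Real.pow_rpow_inv_natCast (by norm_num : (0 : ℝ) ≤ 14.12) hn]
  exact Real.rpow_le_rpow (by positivity) (h2.trans h1) (by positivity)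

lemma eventually_root_avoiders_12453_le : ∀ᶠ n : ℕ in Filter.atTop,
    (avoiders n pat12453 : ℝ) ^ (1 / (n : ℝ)) ≤ 14.66 := by
  filter_upwards [Filter.eventually_ne_atTop 0] with n hn
  have h8 : (1 + √8) ^ 2 ≤ (14.66 : ℝ) := by
    have : √8 ≤ 2.8285 := Real.sqrt_le_iff.2 (by norm_num)
    nlinarith [Real.sqrt_nonneg 8]
  rw [one_div, ← Real.pow_rpow_inv_natCast (by norm_num : (0 : ℝ) ≤ 14.66) hn]
  exact Real.rpow_le_rpow (by positivity) ((avoiders_12453_le n).trans (by gcongr)) (by positivity)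

/-- `liminf (S_n(12453))^{1/n} ≥ 14.12` and `limsup (S_n(12453))^{1/n} ≤ 14.66`;
in particular the sequence does not converge to any integer. -/
theorem stanley_wilf_12453_not_integer :
    14.12 ≤ Filter.liminf (fun n : ℕ => (avoiders n pat12453 : ℝ) ^ (1 / (n : ℝ)))
        Filter.atTop ∧
    Filter.limsup (fun n : ℕ => (avoiders n pat12453 : ℝ) ^ (1 / (n : ℝ)))
        Filter.atTop ≤ 14.66 ∧
    ¬ ∃ m : ℤ, Filter.Tendsto (fun n : ℕ => (avoiders n pat12453 : ℝ) ^ (1 / (n : ℝ)))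
        Filter.atTop (nhds (m : ℝ)) := by
  have hlow := eventually_le_root_avoiders_12453
  have hup := eventually_root_avoiders_12453_le
  refine ⟨Filter.le_liminf_of_le (Filter.IsBoundedUnder.isCoboundedUnder_ge ⟨14.66, hup⟩) hlow,
    Filter.limsup_le_of_le (Filter.IsBoundedUnder.isCoboundedUnder_le ⟨14.12, hlow⟩) hup, ?_⟩
  rintro ⟨m, hm⟩
  have h1 : (14.12 : ℝ) ≤ m := ge_of_tendsto hm hlow
  have h2 : (m : ℝ) ≤ 14.66 := le_of_tendsto hm hup
  have h3 : 14 < m := by exact_mod_cast (by linarith : (14 : ℝ) < m)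
  have h4 : m < 15 := by exact_mod_cast (by linarith : (m : ℝ) < 15)
  omega
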